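/- arXiv:1410.3392 — 2 statements merged into one kernel-verified Lean document; each statement's English description precedes it below -/
import Mathlib

section
/- Let f be a function of critical growth on 𝔹². Then sup{ c² : c ≥ 0 and sup{ ∫_B f(x, c·u(x)) u(x) dv_g : u an H¹_R(𝔹²)-function with ‖u‖ ≤ 1 } < ∞ } = 4π/λ. -/
open MeasureTheory Real Set Filter

noncomputable section

/-- Points of the plane. -/
abbrev Pt := EuclideanSpace ℝ (Fin 2)

/-- The open unit disc `B = {x ∈ ℝ² : |x| < 1}`. -/
def B : Set Pt := Metric.ball 0 1

/-- The density of the hyperbolic volume measure `dv_g = (2/(1-|x|²))² dx`. -/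
def dens (x : Pt) : ℝ := (2 / (1 - ‖x‖ ^ 2)) ^ 2

/-- Integral with respect to the hyperbolic volume measure on `B`. -/
def hInt (φ : Pt → ℝ) : ℝ := ∫ x in B, φ x * dens x

/-- Integrability with respect to the hyperbolic volume measure on `B`. -/
def HIntegrable (φ : Pt → ℝ) : Prop := IntegrableOn (fun x => φ x * dens x) B volume

/-- The squared Euclidean Dirichlet norm `‖u‖² = ∫_B |∇u|² dx` (which equals the
hyperbolic Dirichlet energy by conformal invariance). -/
def enormSq (u : Pt → ℝ) : ℝ := ∫ x in B, ‖gradient u x‖ ^ 2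

/-- `u` is an `H¹(𝔹²)`-function: differentiable on `B`, with finite Dirichlet
energy and finite hyperbolic `L²` norm. -/
def IsH1 (u : Pt → ℝ) : Prop :=
  DifferentiableOn ℝ u B ∧
  IntegrableOn (fun x => ‖gradient u x‖ ^ 2) B volume ∧
  HIntegrable (fun x => (u x) ^ 2)

/-- `u` is an `H¹_R(𝔹²)`-function: an `H¹(𝔹²)`-function which is radial. -/
def IsH1R (u : Pt → ℝ) : Prop :=
  IsH1 u ∧ ∀ x y : Pt, ‖x‖ = ‖y‖ → u x = u y

/-- The nonlinearity `f(x,t) = h(x,t)(e^{λt²} - 1)`. -/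
def fn (lam : ℝ) (h : Pt → ℝ → ℝ) (x : Pt) (t : ℝ) : ℝ :=
  h x t * (Real.exp (lam * t ^ 2) - 1)

/-- The primitive `F(x,t) = ∫₀^t f(x,s) ds`. -/
def Fn (lam : ℝ) (h : Pt → ℝ → ℝ) (x : Pt) (t : ℝ) : ℝ :=
  ∫ s in (0 : ℝ)..t, fn lam h x s

/-- The functional `I_λ(u) = (1/2)∫_B f(x,u)u dv_g - ∫_B F(x,u) dv_g`. -/
def Ilam (lam : ℝ) (h : Pt → ℝ → ℝ) (u : Pt → ℝ) : ℝ :=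
  (1 / 2) * hInt (fun x => fn lam h x (u x) * u x) - hInt (fun x => Fn lam h x (u x))

/-- `f(x,t) = h(x,t)(e^{λt²} - 1)` is a function of critical growth on `𝔹²`. -/
structure CriticalGrowth (lam : ℝ) (h : Pt → ℝ → ℝ) : Prop where
  lam_pos : 0 < lam
  h_C1 : ContDiff ℝ 1 (Function.uncurry h)
  f_pos : ∀ x ∈ B, ∀ t : ℝ, 0 < t → 0 < fn lam h x t
  f_odd : ∀ x ∈ B, ∀ t : ℝ, fn lam h x (-t) = -fn lam h x t
  /-- (C1), first part: `h` is bounded on `B × [-L, L]` for every `L > 0`. -/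
  h_bdd : ∀ L : ℝ, 0 < L → ∃ C : ℝ, ∀ x ∈ B, ∀ t : ℝ, |t| ≤ L → |h x t| ≤ C
  /-- (C1), second part: `sup_{x ∈ B} |h(x,t)| ≤ C tᵃ` near `t = 0`. -/
  h_zero : ∃ a C δ : ℝ, 0 < a ∧ 0 < C ∧ 0 < δ ∧
    ∀ x ∈ B, ∀ t : ℝ, 0 < t → t < δ → |h x t| ≤ C * t ^ a
  /-- (C2): `∂f/∂t (x,t) > f(x,t)/t` for `t > 0`. -/
  f_super : ∀ x ∈ B, ∀ t : ℝ, 0 < t → fn lam h x t / t < deriv (fun s => fn lam h x s) t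
  /-- (C3): `F(x,t) ≤ M₁(g(x) + f(x,t))` with `0 ≤ g ∈ L¹(B, dv_g)`. -/
  F_bound : ∃ M₁ : ℝ, 0 < M₁ ∧ ∃ g : Pt → ℝ, (∀ x, 0 ≤ g x) ∧ HIntegrable g ∧
    ∀ x ∈ B, ∀ t : ℝ, 0 < t → Fn lam h x t ≤ M₁ * (g x + fn lam h x t)
  /-- (C4), first part: `inf_{x ∈ K} h(x,t) e^{εt²} → ∞` as `t → ∞`,
  for every compact `K ⊆ B`. -/
  h_inf : ∀ ε : ℝ, 0 < ε → ∀ K : Set Pt, K ⊆ B → IsCompact K →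
    ∀ c : ℝ, ∃ T : ℝ, ∀ t : ℝ, T ≤ t → ∀ x ∈ K, c ≤ h x t * Real.exp (ε * t ^ 2)
  /-- (C4), second part: `sup_{x ∈ B} h(x,t) e^{-εt²} → 0` as `t → ∞`. -/
  h_sup : ∀ ε : ℝ, 0 < ε → ∀ c : ℝ, 0 < c → ∃ T : ℝ, ∀ t : ℝ, T ≤ t → ∀ x ∈ B,
    h x t * Real.exp (-ε * t ^ 2) < c

lemma integrableOn_B_norm_iff {g : ℝ → ℝ} :
    IntegrableOn (fun x : Pt => g ‖x‖) B ↔ IntegrableOn (fun r => r * g r) (Ioo 0 1) := by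
  have := integrableOn_fun_norm_addHaar (volume : Measure Pt) (f := g) (r := 1)
  simpa [B] using this

lemma integral_B_norm (g : ℝ → ℝ) :
    ∫ x in B, g ‖x‖ = 2 * π * ∫ r in Ioo (0 : ℝ) 1, r * g r := by
  have h1 : ∫ x in B, g ‖x‖ = ∫ x : Pt, (Iio (1 : ℝ)).indicator g ‖x‖ := by
    rw [← integral_indicator (by exact measurableSet_ball)]
    congr 1
    ext x
    simp [indicator, B]
  rw [h1, integral_fun_norm_addHaar (volume : Measure Pt)]
  have h2 : (volume : Measure Pt).real (Metric.ball 0 1) = π := by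
    simp [Measure.real, pi_pos.le]
  have h3 : ∫ y in Ioi (0 : ℝ), y * (Iio (1 : ℝ)).indicator g y
      = ∫ r in Ioo (0 : ℝ) 1, r * g r := by
    rw [← integral_indicator measurableSet_Ioi, ← integral_indicator measurableSet_Ioo]
    congr 1
    ext y
    by_cases h0 : 0 < y <;> by_cases h1 : y < 1 <;> simp [indicator, h0, h1]
  simp only [finrank_euclideanSpace, Fintype.card_fin, h2]
  simp [h3]
  ring

/-- The profile of a function along the first coordinate axis. -/
def profile (u : Pt → ℝ) (r : ℝ) : ℝ := u (r • EuclideanSpace.single 0 1)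

lemma profile_norm {u : Pt → ℝ} (hr : ∀ x y : Pt, ‖x‖ = ‖y‖ → u x = u y) (x : Pt) :
    profile u ‖x‖ = u x := by
  apply hr
  simp [norm_smul]

lemma differentiableAt_profile {u : Pt → ℝ} (hd : DifferentiableOn ℝ u B) {r : ℝ}
    (hr0 : 0 ≤ r) (hr1 : r < 1) : DifferentiableAt ℝ (profile u) r := by
  have hm : r • (EuclideanSpace.single 0 1 : Pt) ∈ B := by
    simp [B, norm_smul, abs_of_nonneg hr0, hr1]
  have h1 : DifferentiableAt ℝ u (r • (EuclideanSpace.single 0 1 : Pt)) :=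
    (hd _ hm).differentiableAt (Metric.isOpen_ball.mem_nhds hm)
  exact h1.comp r (by fun_prop : DifferentiableAt ℝ
    (fun r : ℝ => r • (EuclideanSpace.single 0 1 : Pt)) r)

lemma norm_gradient (u : Pt → ℝ) (x : Pt) : ‖gradient u x‖ = ‖fderiv ℝ u x‖ := by
  rw [gradient, LinearIsometryEquiv.norm_map]

lemma abs_deriv_profile_le {u : Pt → ℝ} (hd : DifferentiableOn ℝ u B)
    (hr : ∀ x y : Pt, ‖x‖ = ‖y‖ → u x = u y) {x : Pt} (hx : x ∈ B) (hx0 : x ≠ 0) :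
    |deriv (profile u) ‖x‖| ≤ ‖gradient u x‖ := by
  have hn : ‖x‖ ≠ 0 := norm_ne_zero_iff.2 hx0
  have hp : profile u = fun s : ℝ => u (s • (‖x‖⁻¹ • x)) := by
    ext s
    apply hr
    simp [norm_smul, hn]
  have hx' : ‖x‖ • (‖x‖⁻¹ • x) = x := by
    rw [smul_smul, mul_inv_cancel₀ hn, one_smul]
  have h1 : HasFDerivAt u (fderiv ℝ u x) (‖x‖ • (‖x‖⁻¹ • x)) := by
    rw [hx']
    exact ((hd _ hx).differentiableAt (Metric.isOpen_ball.mem_nhds hx)).hasFDerivAt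
  have h2 : HasDerivAt (fun s : ℝ => s • (‖x‖⁻¹ • x)) (‖x‖⁻¹ • x) ‖x‖ := by
    simpa using (hasDerivAt_id ‖x‖).smul_const (‖x‖⁻¹ • x)
  have h3 := h1.comp_hasDerivAt ‖x‖ h2
  have h4 : deriv (profile u) ‖x‖ = fderiv ℝ u x (‖x‖⁻¹ • x) := by
    rw [hp]; exact h3.deriv
  rw [h4, norm_gradient, ← Real.norm_eq_abs]
  refine ((fderiv ℝ u x).le_opNorm _).trans ?_
  simp [norm_smul, hn]

lemma profile_energy {u : Pt → ℝ} (hu : IsH1R u) (he : enormSq u ≤ 1) :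
    IntegrableOn (fun r => r * deriv (profile u) r ^ 2) (Ioo 0 1) ∧
    ∫ r in Ioo (0 : ℝ) 1, r * deriv (profile u) r ^ 2 ≤ 1 / (2 * π) := by
  obtain ⟨⟨hd, hg, -⟩, hr⟩ := hu
  have hle : ∀ᵐ x : Pt ∂(volume.restrict B),
      deriv (profile u) ‖x‖ ^ 2 ≤ ‖gradient u x‖ ^ 2 := by
    have h0 : ∀ᵐ x : Pt ∂(volume.restrict B), x ≠ 0 :=
      ae_restrict_of_ae (Measure.ae_ne volume 0)
    filter_upwards [h0, ae_restrict_mem (by exact measurableSet_ball)] with x hx0 hx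
    rw [← sq_abs (deriv _ _)]
    gcongr
    exact abs_deriv_profile_le hd hr hx hx0
  have hi : IntegrableOn (fun x : Pt => deriv (profile u) ‖x‖ ^ 2) B := by
    refine Integrable.mono' hg ?_ ?_
    · exact (((measurable_deriv _).comp measurable_norm).pow_const 2).aestronglyMeasurable
    · filter_upwards [hle] with x hx
      rwa [Real.norm_eq_abs, abs_of_nonneg (sq_nonneg _)]
  refine ⟨(integrableOn_B_norm_iff (g := fun r => deriv (profile u) r ^ 2)).1 hi, ?_⟩
  have h1 := integral_mono_ae hi hg hle
  have h2 := integral_B_norm (fun r => deriv (profile u) r ^ 2)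
  rw [h2] at h1
  have h3 : 2 * π * ∫ r in Ioo (0 : ℝ) 1, r * deriv (profile u) r ^ 2 ≤ 1 := h1.trans he
  rw [le_div_iff₀ (by positivity)]
  linarith

lemma abs_profile_sub_le {u : Pt → ℝ} (hu : IsH1R u) (he : enormSq u ≤ 1) {r s : ℝ}
    (hr : 0 < r) (hrs : r < s) (hs : s < 1) :
    |profile u s - profile u r| ≤ √(log (s / r) / (2 * π)) := by
  obtain ⟨hi, hb⟩ := profile_energy hu he
  set v := deriv (profile u) with hv
  have hl : 0 < log (s / r) := Real.log_pos (by rwa [one_lt_div hr])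
  set A := √(log (s / r) / (2 * π)) with hA
  have hA0 : 0 < A := Real.sqrt_pos.2 (by positivity)
  have hA2 : A ^ 2 = log (s / r) / (2 * π) := Real.sq_sqrt (by positivity)
  have hsub : Ioc r s ⊆ Ioo (0 : ℝ) 1 := fun t ht => ⟨hr.trans ht.1, ht.2.trans_lt hs⟩
  have hi1 : IntervalIntegrable (fun t => t * v t ^ 2) volume r s := by
    rw [intervalIntegrable_iff_integrableOn_Ioc_of_le hrs.le]
    exact hi.mono_set hsub
  have hi2 : IntervalIntegrable (fun t : ℝ => t⁻¹) volume r s := by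
    rw [intervalIntegrable_inv_iff]
    right
    rw [uIcc_of_le hrs.le]
    exact fun h => absurd h.1 (not_le.2 hr)
  -- Young inequality with weight `2 π A`
  have hpt : ∀ t ∈ Icc r s, |v t| ≤ π * A * (t * v t ^ 2) + 1 / (4 * π * A) * t⁻¹ := by
    intro t ht
    have ht0 : 0 < t := hr.trans_le ht.1
    have : π * A * (t * v t ^ 2) + 1 / (4 * π * A) * t⁻¹ - |v t|
        = (2 * π * A * t * |v t| - 1) ^ 2 / (4 * π * A * t) := by
      rw [← sq_abs (v t)]
      field_simp
      ring
    have h0 : 0 ≤ (2 * π * A * t * |v t| - 1) ^ 2 / (4 * π * A * t) := by positivity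
    linarith
  have hi3 := (hi1.const_mul (π * A)).add (hi2.const_mul (1 / (4 * π * A)))
  have hiv : IntervalIntegrable v volume r s := by
    refine hi3.mono_fun (measurable_deriv _).aestronglyMeasurable ?_
    rw [uIoc_of_le hrs.le]
    filter_upwards [ae_restrict_mem measurableSet_Ioc] with t ht
    exact (hpt t (Ioc_subset_Icc_self ht)).trans (le_abs_self _)
  have hftc : ∫ t in r..s, v t = profile u s - profile u r := by
    apply intervalIntegral.integral_eq_sub_of_hasDerivAt _ hiv
    intro t ht
    rw [uIcc_of_le hrs.le] at ht
    exact (differentiableAt_profile hu.1.1 (hr.le.trans ht.1) (ht.2.trans_lt hs)).hasDerivAt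
  have hen : ∫ t in r..s, t * v t ^ 2 ≤ 1 / (2 * π) := by
    rw [intervalIntegral.integral_of_le hrs.le]
    refine le_trans (setIntegral_mono_set hi ?_ hsub.eventuallyLE) hb
    filter_upwards [ae_restrict_mem measurableSet_Ioo] with t ht
    exact mul_nonneg ht.1.le (sq_nonneg _)
  rw [← hftc]
  calc |∫ t in r..s, v t| ≤ ∫ t in r..s, |v t| :=
        intervalIntegral.abs_integral_le_integral_abs hrs.le
    _ ≤ ∫ t in r..s, (π * A * (t * v t ^ 2) + 1 / (4 * π * A) * t⁻¹) :=
        intervalIntegral.integral_mono_on hrs.le hiv.abs hi3 hpt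
    _ = π * A * (∫ t in r..s, t * v t ^ 2) + 1 / (4 * π * A) * log (s / r) := by
        rw [intervalIntegral.integral_add (hi1.const_mul _) (hi2.const_mul _),
          intervalIntegral.integral_const_mul, intervalIntegral.integral_const_mul,
          integral_inv_of_pos hr (hr.trans hrs)]
    _ ≤ π * A * (1 / (2 * π)) + 1 / (4 * π * A) * log (s / r) := by gcongr
    _ = A := by
        have : log (s / r) = A ^ 2 * (2 * π) := by rw [hA2]; field_simp
        rw [this]
        field_simp
        ring

lemma exists_abs_profile_lt {u : Pt → ℝ} (hu : IsH1R u) {a η : ℝ} (ha0 : 0 < a) (ha1 : a < 1)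
    (hη : 0 < η) : ∃ s ∈ Ioo a 1, |profile u s| < η := by
  by_contra! hcon
  have hi : IntegrableOn (fun x : Pt => profile u ‖x‖ ^ 2 * (2 / (1 - ‖x‖ ^ 2)) ^ 2) B := by
    simp_rw [profile_norm hu.2]
    exact hu.1.2.2
  have hi2 := (integrableOn_B_norm_iff
    (g := fun r => profile u r ^ 2 * (2 / (1 - r ^ 2)) ^ 2)).1 hi
  have hi3 : IntegrableOn (fun r => (a * η ^ 2)⁻¹ *
      (r * (profile u r ^ 2 * (2 / (1 - r ^ 2)) ^ 2))) (Ioo a 1) :=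
    (hi2.mono_set (Ioo_subset_Ioo_left ha0.le)).const_mul _
  have hi4 : IntegrableOn (fun r : ℝ => (r - 1)⁻¹) (Ioo a 1) := by
    refine Integrable.mono' hi3 (by fun_prop) ?_
    filter_upwards [ae_restrict_mem measurableSet_Ioo] with r hr
    have h1 : 0 < 1 - r := by linarith [hr.2]
    have h1' : r - 1 < 0 := by linarith
    have hr0 : 0 < r := ha0.trans hr.1
    have h2 : η ^ 2 ≤ profile u r ^ 2 := by
      rw [← sq_abs (profile u r)]
      gcongr
      exact hcon r hr
    have h3 : (1 - r)⁻¹ ≤ (2 / (1 - r ^ 2)) ^ 2 := by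
      have : (2 / (1 - r ^ 2)) ^ 2 = 4 / ((1 - r) ^ 2 * (1 + r) ^ 2) := by
        rw [div_pow, show 1 - r ^ 2 = (1 - r) * (1 + r) by ring, mul_pow]
        norm_num
      rw [this, ← one_div, div_le_div_iff₀ h1 (by positivity)]
      have h5 : (1 + r) ^ 2 ≤ 4 := by nlinarith [hr.2]
      have h6 : (1 - r) ^ 2 ≤ 1 - r := by nlinarith
      nlinarith [sq_nonneg (1 - r), sq_nonneg (1 + r)]
    rw [norm_inv, Real.norm_eq_abs, abs_of_neg h1', neg_sub,
      inv_mul_eq_div, le_div_iff₀ (by positivity), mul_comm]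
    calc a * η ^ 2 * (1 - r)⁻¹ ≤ r * profile u r ^ 2 * (2 / (1 - r ^ 2)) ^ 2 := by
          gcongr
          exact hr.1.le
      _ = _ := by ring
  have h5 : IntervalIntegrable (fun r : ℝ => (r - 1)⁻¹) volume a 1 := by
    rwa [intervalIntegrable_iff_integrableOn_Ioo_of_le ha1.le]
  rw [intervalIntegrable_sub_inv_iff] at h5
  rcases h5 with h5 | h5
  · exact ha1.ne h5
  · exact h5 right_mem_uIcc

lemma sq_le_log {u : Pt → ℝ} (hu : IsH1R u) (he : enormSq u ≤ 1) {x : Pt} (hx : x ∈ B)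
    (hx0 : x ≠ 0) : u x ^ 2 ≤ -log ‖x‖ / (2 * π) := by
  have hr : 0 < ‖x‖ := norm_pos_iff.2 hx0
  have hr1 : ‖x‖ < 1 := by simpa [B] using hx
  have key : |u x| ≤ √(-log ‖x‖ / (2 * π)) := by
    refine le_of_forall_pos_le_add fun η hη => ?_
    obtain ⟨s, hs, hsη⟩ := exists_abs_profile_lt hu hr hr1 hη
    have h1 := abs_profile_sub_le hu he hr hs.1 hs.2
    have h2 : √(log (s / ‖x‖) / (2 * π)) ≤ √(-log ‖x‖ / (2 * π)) := by
      apply Real.sqrt_le_sqrt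
      gcongr
      rw [← Real.log_inv, ← one_div]
      have : 0 < s := hr.trans hs.1
      gcongr
      exact hs.2.le
    rw [profile_norm hu.2] at h1
    have h3 := abs_sub_abs_le_abs_sub (u x) (profile u s)
    rw [abs_sub_comm] at h3
    linarith
  have h0 : 0 ≤ -log ‖x‖ / (2 * π) := by
    have := Real.log_nonpos hr.le hr1.le
    have : 0 ≤ -log ‖x‖ := by linarith
    positivity
  rw [← sq_abs, ← Real.sq_sqrt h0]
  gcongr

lemma integrableOn_rpow_mul_one_sub_rpow {p q : ℝ} (hp : -1 < p) (hq : -1 < q) :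
    IntegrableOn (fun r : ℝ => r ^ p * (1 - r) ^ q) (Ioo 0 1) := by
  have h := Complex.betaIntegral_convergent (u := ((p + 1 : ℝ) : ℂ)) (v := ((q + 1 : ℝ) : ℂ))
    (by simpa using by linarith) (by simpa using by linarith)
  rw [intervalIntegrable_iff_integrableOn_Ioo_of_le zero_le_one] at h
  refine IntegrableOn.congr_fun h.norm (fun r hr => ?_) measurableSet_Ioo
  have h1 : 0 < 1 - r := by linarith [hr.2]
  simp only [norm_mul]
  rw [Complex.norm_cpow_eq_rpow_re_of_pos hr.1,
    show (1 - (r : ℂ)) = ((1 - r : ℝ) : ℂ) by push_cast; rfl,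
    Complex.norm_cpow_eq_rpow_re_of_pos h1]
  simp

lemma neg_log_le {r γ : ℝ} (hr0 : 0 < r) (hr1 : r < 1) (hγ0 : 0 < γ) (hγ1 : γ ≤ 1) :
    -log r ≤ r ^ (-γ) * (1 - r) / γ := by
  have h1 := Real.log_le_sub_one_of_pos (Real.rpow_pos_of_pos hr0 (-γ))
  rw [Real.log_rpow hr0] at h1
  have h2 : r ≤ r ^ γ := by
    simpa using Real.rpow_le_rpow_of_exponent_ge hr0 hr1.le hγ1
  have h3 : 0 < r ^ (-γ) := Real.rpow_pos_of_pos hr0 _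
  have h4 : r ^ (-γ) * r ^ γ = 1 := by
    rw [← Real.rpow_add hr0]; simp
  rw [le_div_iff₀ hγ0]
  nlinarith

lemma exp_sub_one_le_mul_exp (y : ℝ) : Real.exp y - 1 ≤ y * Real.exp y := by
  have h1 := Real.add_one_le_exp (-y)
  have h2 := Real.exp_pos y
  have h3 : Real.exp (-y) * Real.exp y = 1 := by rw [← Real.exp_add]; simp
  nlinarith

lemma exists_fn_le {lam : ℝ} {h : Pt → ℝ → ℝ} (hf : CriticalGrowth lam h) {ε : ℝ}
    (hε : 0 < ε) : ∃ C : ℝ, 0 < C ∧ ∀ x ∈ B, ∀ t : ℝ, 0 ≤ t →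
      fn lam h x t ≤ C * t ^ 2 * Real.exp ((lam + ε) * t ^ 2) := by
  obtain ⟨T, hT⟩ := hf.h_sup ε hε 1 one_pos
  obtain ⟨C, hC⟩ := hf.h_bdd (max T 1) (by positivity)
  have hl := hf.lam_pos
  have hh : ∀ x ∈ B, ∀ t : ℝ, 0 ≤ t → h x t ≤ max C 1 * Real.exp (ε * t ^ 2) := by
    intro x hx t ht
    rcases le_total t (max T 1) with htT | htT
    · have h1 := (le_abs_self _).trans (hC x hx t (by rwa [abs_of_nonneg ht]))
      have h2 : 1 ≤ Real.exp (ε * t ^ 2) := Real.one_le_exp (by positivity)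
      calc h x t ≤ max C 1 * 1 := by rw [mul_one]; exact h1.trans (le_max_left _ _)
        _ ≤ _ := by gcongr
    · have h1 := hT t ((le_max_left _ _).trans htT) x hx
      have h2 : Real.exp (-ε * t ^ 2) * Real.exp (ε * t ^ 2) = 1 := by
        rw [← Real.exp_add]; simp
      have h3 := Real.exp_pos (ε * t ^ 2)
      calc h x t = h x t * Real.exp (-ε * t ^ 2) * Real.exp (ε * t ^ 2) := by
            rw [mul_assoc, h2, mul_one]
        _ ≤ max C 1 * Real.exp (ε * t ^ 2) := by
            gcongr
            exact h1.le.trans (le_max_right _ _)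
  refine ⟨max C 1 * lam, by positivity, fun x hx t ht => ?_⟩
  have h1 : 0 ≤ Real.exp (lam * t ^ 2) - 1 := by
    have := Real.one_le_exp (x := lam * t ^ 2) (by positivity)
    linarith
  calc fn lam h x t = h x t * (Real.exp (lam * t ^ 2) - 1) := rfl
    _ ≤ max C 1 * Real.exp (ε * t ^ 2) * (lam * t ^ 2 * Real.exp (lam * t ^ 2)) := by
        gcongr
        · exact hh x hx t ht
        · exact exp_sub_one_le_mul_exp _
    _ = _ := by rw [add_mul, Real.exp_add]; ring

lemma fn_mul_self_eq {lam : ℝ} {h : Pt → ℝ → ℝ} (hf : CriticalGrowth lam h) {x : Pt}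
    (hx : x ∈ B) (c t : ℝ) : fn lam h x (c * t) * t = fn lam h x (c * |t|) * |t| := by
  rcases abs_choice t with ht | ht <;> rw [ht]
  rw [mul_neg c t, hf.f_odd x hx]
  ring

lemma dens_le {x : Pt} (hx : x ∈ B) : dens x ≤ 4 * (1 - ‖x‖) ^ (-2 : ℝ) := by
  have hr1 : 0 < 1 - ‖x‖ := by
    have : ‖x‖ < 1 := by simpa [B] using hx
    linarith
  have h0 := norm_nonneg x
  rw [Real.rpow_neg hr1.le, Real.rpow_two, dens, ← div_eq_mul_inv, div_pow,
    show 1 - ‖x‖ ^ 2 = (1 - ‖x‖) * (1 + ‖x‖) by ring, mul_pow]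
  norm_num
  gcongr
  have : 1 ≤ (1 + ‖x‖) ^ 2 := by nlinarith
  nlinarith [sq_nonneg (1 - ‖x‖)]

lemma exists_integrand_le {lam : ℝ} {h : Pt → ℝ → ℝ} (hf : CriticalGrowth lam h) {c : ℝ}
    (hc : 0 ≤ c) (hcl : lam * c ^ 2 < 4 * π) : ∃ K β : ℝ, 0 ≤ K ∧ β < 2 ∧
      ∀ u : Pt → ℝ, IsH1R u → enormSq u ≤ 1 → ∀ x ∈ B, x ≠ 0 →
        fn lam h x (c * u x) * u x * dens x
          ≤ K * (‖x‖ ^ (-β) * (1 - ‖x‖) ^ (-(1 / 2) : ℝ)) := by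
  have hlam := hf.lam_pos
  have hpi := Real.pi_pos
  obtain ⟨ε, hε, hεc⟩ : ∃ ε : ℝ, 0 < ε ∧ (lam + ε) * c ^ 2 < 4 * π := by
    have h1 : 0 < 4 * π - lam * c ^ 2 := by linarith
    refine ⟨(4 * π - lam * c ^ 2) / (2 * (c ^ 2 + 1)), by positivity, ?_⟩
    have h2 : (4 * π - lam * c ^ 2) / (2 * (c ^ 2 + 1)) * c ^ 2
        ≤ (4 * π - lam * c ^ 2) / 2 := by
      rw [div_mul_eq_mul_div, div_le_div_iff₀ (by positivity) (by positivity)]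
      nlinarith [sq_nonneg c]
    linarith
  obtain ⟨C, hC, hfn⟩ := exists_fn_le hf hε
  set κ := (lam + ε) * c ^ 2 / (2 * π) with hκ
  have hκ0 : 0 ≤ κ := by positivity
  have hκ2 : κ < 2 := by
    rw [hκ, div_lt_iff₀ (by positivity)]
    linarith
  set γ := (2 - κ) / 3 with hγ
  have hγ0 : 0 < γ := by rw [hγ]; linarith
  have hγ1 : γ ≤ 1 := by rw [hγ]; linarith
  refine ⟨4 * C * c ^ 2 * (1 / (γ * (2 * π))) ^ (3 / 2 : ℝ), κ + γ * (3 / 2), by positivity,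
    by rw [hγ]; linarith, fun u hu he x hx hx0 => ?_⟩
  have hsq := sq_le_log hu he hx hx0
  have hr0 : 0 < ‖x‖ := norm_pos_iff.2 hx0
  have hr1 : ‖x‖ < 1 := by simpa [B] using hx
  have hr1' : 0 < 1 - ‖x‖ := by linarith
  set r := ‖x‖ with hr
  have hlog : |u x| ^ 2 ≤ r ^ (-γ) * (1 - r) * (1 / (γ * (2 * π))) := by
    rw [sq_abs]
    refine hsq.trans ?_
    calc -log r / (2 * π) ≤ (r ^ (-γ) * (1 - r) / γ) / (2 * π) := by
          gcongr
          exact neg_log_le hr0 hr1 hγ0 hγ1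
      _ = _ := by field_simp
  have hcube : |u x| ^ 3 ≤ r ^ (-(γ * (3 / 2))) * (1 - r) ^ (3 / 2 : ℝ)
      * (1 / (γ * (2 * π))) ^ (3 / 2 : ℝ) := by
    have h1 : |u x| ^ 3 = (|u x| ^ 2) ^ (3 / 2 : ℝ) := by
      rw [← Real.rpow_natCast, ← Real.rpow_natCast, ← Real.rpow_mul (abs_nonneg _)]
      norm_num
    rw [h1, ← neg_mul, Real.rpow_mul hr0.le, ← Real.mul_rpow (by positivity) hr1'.le,
      ← Real.mul_rpow (by positivity) (by positivity)]
    gcongr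
  have hexp : Real.exp ((lam + ε) * (c * |u x|) ^ 2) ≤ r ^ (-κ) := by
    rw [Real.rpow_def_of_pos hr0, Real.exp_le_exp]
    calc (lam + ε) * (c * |u x|) ^ 2 = (lam + ε) * c ^ 2 * u x ^ 2 := by
          rw [mul_pow, sq_abs]; ring
      _ ≤ (lam + ε) * c ^ 2 * (-log r / (2 * π)) := by gcongr
      _ = log r * -κ := by rw [hκ]; ring
  have hd0 : 0 ≤ dens x := sq_nonneg _
  rw [fn_mul_self_eq hf hx]
  calc fn lam h x (c * |u x|) * |u x| * dens x
      ≤ (C * (c * |u x|) ^ 2 * Real.exp ((lam + ε) * (c * |u x|) ^ 2)) * |u x| * dens x := by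
        gcongr
        exact hfn x hx _ (by positivity)
    _ = C * c ^ 2 * |u x| ^ 3 * Real.exp ((lam + ε) * (c * |u x|) ^ 2) * dens x := by ring
    _ ≤ C * c ^ 2 * (r ^ (-(γ * (3 / 2))) * (1 - r) ^ (3 / 2 : ℝ)
          * (1 / (γ * (2 * π))) ^ (3 / 2 : ℝ)) * r ^ (-κ) * (4 * (1 - r) ^ (-2 : ℝ)) := by
        gcongr
        exact dens_le hx
    _ = _ := by
        rw [show -(κ + γ * (3 / 2)) = -(γ * (3 / 2)) + -κ by ring, Real.rpow_add hr0,
          show (-(1 / 2) : ℝ) = 3 / 2 + -2 by norm_num, Real.rpow_add hr1']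
        ring

lemma exists_lintegral_le {lam : ℝ} {h : Pt → ℝ → ℝ} (hf : CriticalGrowth lam h) {c : ℝ}
    (hc : 0 ≤ c) (hcl : lam * c ^ 2 < 4 * π) : ∃ M : ℝ, ∀ u : Pt → ℝ, IsH1R u →
      enormSq u ≤ 1 → ∫⁻ x in B, ENNReal.ofReal (fn lam h x (c * u x) * u x * dens x)
        ≤ ENNReal.ofReal M := by
  obtain ⟨K, β, hK, hβ, hle⟩ := exists_integrand_le hf hc hcl
  set g : ℝ → ℝ := fun r => K * (r ^ (-β) * (1 - r) ^ (-(1 / 2) : ℝ)) with hg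
  have hi : IntegrableOn (fun x : Pt => g ‖x‖) B := by
    rw [integrableOn_B_norm_iff]
    have h1 := (integrableOn_rpow_mul_one_sub_rpow (p := 1 - β) (q := -(1 / 2))
      (by linarith) (by norm_num)).const_mul K
    refine IntegrableOn.congr_fun h1 (fun r hr => ?_) measurableSet_Ioo
    simp only [hg]
    rw [sub_eq_add_neg, Real.rpow_add hr.1, Real.rpow_one]
    ring
  refine ⟨∫ x in B, g ‖x‖, fun u hu he => ?_⟩
  rw [ofReal_integral_eq_lintegral_ofReal hi]
  · apply lintegral_mono_ae
    filter_upwards [ae_restrict_of_ae (Measure.ae_ne volume 0),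
      ae_restrict_mem (by exact measurableSet_ball)] with x hx0 hx
    exact ENNReal.ofReal_le_ofReal (hle u hu he x hx hx0)
  · filter_upwards [ae_restrict_mem (by exact measurableSet_ball)] with x hx
    have hr1 : ‖x‖ < 1 := by simpa [B] using hx
    have hr1' : 0 ≤ 1 - ‖x‖ := by linarith
    have := norm_nonneg x
    simp only [hg, Pi.zero_apply]
    positivity

/-- A smooth truncation of the radial logarithm: it vanishes on the unit circle, and its Dirichlet
energy in the unit disc is at most one. -/
def logProfile (δ : ℝ) (x : Pt) : ℝ :=
  1 / (2 * √(π * log ((1 + δ) / δ))) * (log (1 + δ) - log (‖x‖ ^ 2 + δ))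

lemma hasFDerivAt_logProfile {δ : ℝ} (hδ : 0 < δ) (x : Pt) :
    HasFDerivAt (logProfile δ) ((1 / (2 * √(π * log ((1 + δ) / δ)))) •
      -((‖x‖ ^ 2 + δ)⁻¹ • ((2 : ℝ) • innerSL ℝ x))) x := by
  have h1 : HasFDerivAt (fun y : Pt => ‖y‖ ^ 2) ((2 : ℝ) • innerSL ℝ x) x := by
    have h2 := (hasStrictFDerivAt_norm_sq x).hasFDerivAt
    rwa [two_nsmul, ← two_smul ℝ] at h2
  exact (((h1.add_const δ).log (by positivity)).const_sub (log (1 + δ))).const_mul _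

lemma log_ratio_pos {δ : ℝ} (hδ : 0 < δ) : 0 < log ((1 + δ) / δ) :=
  Real.log_pos (by rw [one_lt_div hδ]; linarith)

lemma norm_gradient_logProfile_sq {δ : ℝ} (hδ : 0 < δ) (x : Pt) :
    ‖gradient (logProfile δ) x‖ ^ 2
      = ‖x‖ ^ 2 / (‖x‖ ^ 2 + δ) ^ 2 / (π * log ((1 + δ) / δ)) := by
  have hL := log_ratio_pos hδ
  have hpos : 0 < π * log ((1 + δ) / δ) := by positivity
  have hs := Real.sq_sqrt hpos.le
  rw [norm_gradient, (hasFDerivAt_logProfile hδ x).fderiv, norm_smul, norm_neg, norm_smul,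
    norm_smul, innerSL_apply_norm]
  simp only [norm_inv, norm_div, norm_mul, Real.norm_eq_abs, mul_pow, sq_abs, div_pow, inv_pow,
    hs]
  norm_num
  field_simp

lemma integral_div_sq_add_le {δ : ℝ} (hδ : 0 < δ) :
    ∫ r in Ioo (0 : ℝ) 1, r * (r ^ 2 / (r ^ 2 + δ) ^ 2) ≤ log ((1 + δ) / δ) / 2 := by
  have hne : ∀ r : ℝ, r ^ 2 + δ ≠ 0 := fun r => by positivity
  have hc1 : Continuous fun r : ℝ => r * (r ^ 2 / (r ^ 2 + δ) ^ 2) := by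
    fun_prop (disch := exact fun r => pow_ne_zero 2 (hne r))
  have hc2 : Continuous fun r : ℝ => r / (r ^ 2 + δ) := by
    fun_prop (disch := exact hne)
  have hftc : ∫ r in (0 : ℝ)..1, r / (r ^ 2 + δ) = log ((1 + δ) / δ) / 2 := by
    rw [intervalIntegral.integral_eq_sub_of_hasDerivAt (f := fun r => log (r ^ 2 + δ) / 2)]
    · rw [Real.log_div (by positivity) hδ.ne']
      norm_num
      ring
    · intro r _
      have h1 := (((hasDerivAt_pow 2 r).add_const δ).log (hne r)).div_const 2
      refine h1.congr_deriv ?_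
      have := hne r
      norm_num
      field_simp
    · exact hc2.intervalIntegrable _ _
  rw [← integral_Ioc_eq_integral_Ioo, ← intervalIntegral.integral_of_le zero_le_one, ← hftc]
  refine intervalIntegral.integral_mono_on zero_le_one (hc1.intervalIntegrable _ _)
    (hc2.intervalIntegrable _ _) fun r hr => ?_
  have := hr.1
  rw [← mul_div_assoc, div_le_div_iff₀ (by positivity) (by positivity)]
  have h2 : 0 ≤ r * (r ^ 2 + δ) * δ := by positivity
  nlinarith

lemma enormSq_logProfile_le {δ : ℝ} (hδ : 0 < δ) : enormSq (logProfile δ) ≤ 1 := by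
  have hL := log_ratio_pos hδ
  simp only [enormSq, norm_gradient_logProfile_sq hδ]
  rw [integral_B_norm (fun r => r ^ 2 / (r ^ 2 + δ) ^ 2 / (π * log ((1 + δ) / δ)))]
  simp only [← mul_div_assoc]
  rw [integral_div]
  simp only [mul_div_assoc]
  rw [← mul_div_assoc, div_le_one (by positivity)]
  have := integral_div_sq_add_le hδ
  have hpi := Real.pi_pos
  nlinarith

lemma logProfile_nonneg {δ : ℝ} (hδ : 0 < δ) {x : Pt} (hx : x ∈ B) : 0 ≤ logProfile δ x := by
  have hr1 : ‖x‖ < 1 := by simpa [B] using hx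
  have h0 := norm_nonneg x
  have h2 : log (‖x‖ ^ 2 + δ) ≤ log (1 + δ) := by
    gcongr
    exact pow_le_one₀ h0 hr1.le
  exact mul_nonneg (by positivity) (sub_nonneg.2 h2)

lemma logProfile_le {δ : ℝ} (hδ : 0 < δ) (x : Pt) :
    logProfile δ x ≤ 1 / (2 * √(π * log ((1 + δ) / δ))) * ((1 - ‖x‖ ^ 2) / (‖x‖ ^ 2 + δ)) := by
  rw [logProfile]
  gcongr
  rw [← Real.log_div (by positivity) (by positivity)]
  refine (Real.log_le_sub_one_of_pos (by positivity)).trans (le_of_eq ?_)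
  field_simp
  ring

lemma isH1R_logProfile {δ : ℝ} (hδ : 0 < δ) : IsH1R (logProfile δ) := by
  have hd : Differentiable ℝ (logProfile δ) :=
    fun x => (hasFDerivAt_logProfile hδ x).differentiableAt
  refine ⟨⟨hd.differentiableOn, ?_, ?_⟩, fun x y hxy => by simp only [logProfile, hxy]⟩
  · simp only [norm_gradient_logProfile_sq hδ]
    have hc : Continuous fun x : Pt => ‖x‖ ^ 2 / (‖x‖ ^ 2 + δ) ^ 2 / (π * log ((1 + δ) / δ)) := by
      refine Continuous.div_const (Continuous.div (by fun_prop) (by fun_prop) fun x => ?_) _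
      positivity
    exact (hc.continuousOn.integrableOn_compact (isCompact_closedBall 0 1)).mono_set
      Metric.ball_subset_closedBall
  · set a := 1 / (2 * √(π * log ((1 + δ) / δ))) with ha
    have ha0 : 0 ≤ a := by positivity
    refine IntegrableOn.of_bound (C := (2 * a / δ) ^ 2) measure_ball_lt_top ?_ ?_
    · have h1 : Measurable (logProfile δ) := hd.continuous.measurable
      have h2 : Measurable dens := by
        unfold dens
        fun_prop
      exact ((h1.pow_const 2).mul h2).aestronglyMeasurable
    · filter_upwards [ae_restrict_mem (by exact measurableSet_ball)] with x hx
      have hr1 : ‖x‖ < 1 := by simpa [B] using hx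
      have h0 := norm_nonneg x
      have hp : 0 < 1 - ‖x‖ ^ 2 := by nlinarith
      have h1 := logProfile_nonneg hδ hx
      have h2 : logProfile δ x ≤ a * ((1 - ‖x‖ ^ 2) / δ) := by
        refine (logProfile_le hδ x).trans ?_
        rw [← ha]
        gcongr
        nlinarith
      rw [dens, ← mul_pow, Real.norm_eq_abs, abs_of_nonneg (sq_nonneg _)]
      gcongr
      calc logProfile δ x * (2 / (1 - ‖x‖ ^ 2))
          ≤ a * ((1 - ‖x‖ ^ 2) / δ) * (2 / (1 - ‖x‖ ^ 2)) := by gcongr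
        _ = 2 * a / δ := by field_simp

lemma exists_le_fn {lam : ℝ} {h : Pt → ℝ → ℝ} (hf : CriticalGrowth lam h) {ε : ℝ}
    (hε : 0 < ε) : ∃ T : ℝ, 0 < T ∧ ∀ x ∈ Metric.closedBall (0 : Pt) (1 / 2), ∀ t : ℝ, T ≤ t →
      Real.exp ((lam - ε) * t ^ 2) / 2 ≤ fn lam h x t := by
  have hl := hf.lam_pos
  obtain ⟨T, hT⟩ := hf.h_inf ε hε (Metric.closedBall 0 (1 / 2))
    (Metric.closedBall_subset_ball (by norm_num)) (isCompact_closedBall _ _) 1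
  refine ⟨max (max T 1) (1 / lam), by positivity, fun x hx t ht => ?_⟩
  have ht1 : T ≤ t := (le_max_left _ _).trans ((le_max_left _ _).trans ht)
  have ht2 : 1 ≤ t := (le_max_right _ _).trans ((le_max_left _ _).trans ht)
  have ht3 : 1 ≤ lam * t := by
    have := (le_max_right _ _).trans ht
    rw [div_le_iff₀ hl] at this
    linarith
  have h1 := hT t ht1 x hx
  have h2 : 2 ≤ Real.exp (lam * t ^ 2) := by
    have := Real.add_one_le_exp (lam * t ^ 2)
    nlinarith
  have h3 : Real.exp (ε * t ^ 2) * Real.exp (-(ε * t ^ 2)) = 1 := by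
    rw [← Real.exp_add]; simp
  have h4 : Real.exp (-(ε * t ^ 2)) ≤ h x t := by
    calc Real.exp (-(ε * t ^ 2)) ≤ h x t * Real.exp (ε * t ^ 2) * Real.exp (-(ε * t ^ 2)) :=
          le_mul_of_one_le_left (Real.exp_pos _).le h1
      _ = h x t := by rw [mul_assoc, h3, mul_one]
  calc Real.exp ((lam - ε) * t ^ 2) / 2
      = Real.exp (-(ε * t ^ 2)) * (Real.exp (lam * t ^ 2) / 2) := by
        rw [← mul_div_assoc, ← Real.exp_add]
        ring_nf
    _ ≤ h x t * (Real.exp (lam * t ^ 2) - 1) := by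
        have : 0 < Real.exp (-(ε * t ^ 2)) := Real.exp_pos _
        have : Real.exp (lam * t ^ 2) / 2 ≤ Real.exp (lam * t ^ 2) - 1 := by linarith
        have h5 : 0 ≤ h x t := (Real.exp_pos _).le.trans h4
        gcongr

lemma le_logProfile {δ : ℝ} (hδ : 0 < δ) {x : Pt} (hx : ‖x‖ ^ 2 ≤ δ) :
    1 / (2 * √(π * log ((1 + δ) / δ))) * (log ((1 + δ) / δ) - log 2) ≤ logProfile δ x := by
  have h1 : log (‖x‖ ^ 2 + δ) ≤ log δ + log 2 := by
    rw [← Real.log_mul hδ.ne' two_ne_zero]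
    gcongr
    linarith
  have h2 : log ((1 + δ) / δ) - log 2 ≤ log (1 + δ) - log (‖x‖ ^ 2 + δ) := by
    rw [Real.log_div (by positivity) hδ.ne']
    linarith
  rw [logProfile]
  gcongr

lemma not_exists_lintegral_le {lam : ℝ} {h : Pt → ℝ → ℝ} (hf : CriticalGrowth lam h) {c : ℝ}
    (hc : 0 < c) (hcl : 4 * π < lam * c ^ 2) (M : ℝ) : ∃ u : Pt → ℝ, IsH1R u ∧
      enormSq u ≤ 1 ∧ ENNReal.ofReal M <
        ∫⁻ x in B, ENNReal.ofReal (fn lam h x (c * u x) * u x * dens x) := by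
  have hlam := hf.lam_pos
  have hpi := Real.pi_pos
  obtain ⟨ε, hε, hεc⟩ : ∃ ε : ℝ, 0 < ε ∧ 4 * π < (lam - ε) * c ^ 2 := by
    refine ⟨(lam * c ^ 2 - 4 * π) / (2 * c ^ 2), by
      have : 0 < lam * c ^ 2 - 4 * π := by linarith
      positivity, ?_⟩
    have : (lam * c ^ 2 - 4 * π) / (2 * c ^ 2) * c ^ 2 = (lam * c ^ 2 - 4 * π) / 2 := by
      field_simp
    rw [sub_mul, this]
    linarith
  obtain ⟨T, hT0, hT⟩ := exists_le_fn hf hε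
  set κ := (lam - ε) * c ^ 2 / (4 * π) with hκ
  have hκ1 : 1 < κ := by rwa [hκ, one_lt_div (by positivity)]
  have hlε : 0 < lam - ε := by
    by_contra! hcon
    nlinarith [sq_nonneg c]
  obtain ⟨L, hL5, hLT, hLM⟩ : ∃ L : ℝ, 5 ≤ L ∧ T ^ 2 ≤ c ^ 2 / (4 * π) * (L - 2 * log 2) ∧
      M < T / c * π / 2 * Real.exp (-(κ * (2 * log 2))) * Real.exp ((κ - 1) * L) := by
    have e1 : ∀ᶠ L : ℝ in atTop, 5 ≤ L := eventually_ge_atTop 5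
    have e2 : Tendsto (fun L : ℝ => c ^ 2 / (4 * π) * (L - 2 * log 2)) atTop atTop :=
      (tendsto_atTop_add_const_right _ _ tendsto_id).const_mul_atTop (by positivity)
    have e3 : Tendsto (fun L : ℝ => T / c * π / 2 * Real.exp (-(κ * (2 * log 2)))
        * Real.exp ((κ - 1) * L)) atTop atTop :=
      (Real.tendsto_exp_atTop.comp (tendsto_id.const_mul_atTop (by linarith))).const_mul_atTop
        (by positivity)
    obtain ⟨L, h1, h2, h3⟩ := (e1.and ((e2.eventually_ge_atTop (T ^ 2)).and
      (e3.eventually_gt_atTop M))).exists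
    exact ⟨L, h1, h2, h3⟩
  have hexp : 6 ≤ Real.exp L := by linarith [Real.add_one_le_exp L]
  set δ := 1 / (Real.exp L - 1) with hδ
  have hδ0 : 0 < δ := by
    have : 0 < Real.exp L - 1 := by linarith
    positivity
  have hδ1 : δ ≤ 1 / 4 := by
    rw [hδ]
    gcongr
    linarith
  have hratio : (1 + δ) / δ = Real.exp L := by
    have : Real.exp L - 1 ≠ 0 := by linarith
    rw [hδ]
    field_simp
    ring
  have hδL : Real.exp (-L) ≤ δ := by
    rw [Real.exp_neg, ← hratio, inv_div]
    apply div_le_self hδ0.le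
    linarith
  have hlog : log ((1 + δ) / δ) = L := by rw [hratio, Real.log_exp]
  refine ⟨logProfile δ, isH1R_logProfile hδ0, enormSq_logProfile_le hδ0, ?_⟩
  set t₀ := c * (1 / (2 * √(π * L)) * (L - log 2)) with ht₀
  have hlog2 : 0 < log 2 := Real.log_pos one_lt_two
  have hlog2' : log 2 < 1 := by linarith [Real.log_two_lt_d9]
  have ht₀0 : 0 ≤ t₀ := by
    have : 0 ≤ L - log 2 := by linarith
    positivity
  have ht₀sq : c ^ 2 / (4 * π) * (L - 2 * log 2) ≤ t₀ ^ 2 := by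
    have : t₀ ^ 2 = c ^ 2 / (4 * π) * ((L - log 2) ^ 2 / L) := by
      rw [ht₀, mul_pow, mul_pow, div_pow, mul_pow 2, Real.sq_sqrt (by positivity)]
      field_simp
      ring
    rw [this]
    gcongr
    rw [le_div_iff₀ (by linarith)]
    nlinarith [sq_nonneg (log 2)]
  have hTt₀ : T ≤ t₀ := by
    rw [← sq_le_sq₀ hT0.le ht₀0]
    exact hLT.trans ht₀sq
  have hsub : Metric.ball (0 : Pt) √δ ⊆ B := by
    apply Metric.ball_subset_ball
    rw [Real.sqrt_le_one]
    linarith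
  have hlow : ∀ x ∈ Metric.ball (0 : Pt) √δ,
      Real.exp (κ * (L - 2 * log 2)) / 2 * (T / c)
        ≤ fn lam h x (c * logProfile δ x) * logProfile δ x * dens x := by
    intro x hx
    have hxδ : ‖x‖ ^ 2 ≤ δ := by
      have h1 : ‖x‖ < √δ := by simpa using hx
      rw [← Real.sq_sqrt hδ0.le]
      gcongr
    have hxK : x ∈ Metric.closedBall (0 : Pt) (1 / 2) := by
      rw [mem_closedBall_zero_iff, ← sq_le_sq₀ (norm_nonneg _) (by norm_num)]
      linarith
    have h1 := le_logProfile hδ0 hxδ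
    rw [hlog] at h1
    have h2 : t₀ ≤ c * logProfile δ x := by rw [ht₀]; gcongr
    have h3 := hT x hxK _ (hTt₀.trans h2)
    have h4 : T / c ≤ logProfile δ x := by
      rw [div_le_iff₀' hc]
      exact hTt₀.trans h2
    have h5 : 1 ≤ dens x := by
      have hn := norm_nonneg x
      have : 1 ≤ 2 / (1 - ‖x‖ ^ 2) := by
        rw [le_div_iff₀] <;> nlinarith
      rw [dens]
      exact one_le_pow₀ this
    have h6 : κ * (L - 2 * log 2) ≤ (lam - ε) * (c * logProfile δ x) ^ 2 := by
      calc κ * (L - 2 * log 2) = (lam - ε) * (c ^ 2 / (4 * π) * (L - 2 * log 2)) := by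
            rw [hκ]
            ring
        _ ≤ (lam - ε) * (c * logProfile δ x) ^ 2 := by
            gcongr
            exact ht₀sq.trans (by gcongr)
    have h7 : Real.exp (κ * (L - 2 * log 2)) / 2 ≤ fn lam h x (c * logProfile δ x) :=
      le_trans (by gcongr) h3
    have h8 : 0 < Real.exp (κ * (L - 2 * log 2)) / 2 := by positivity
    have h9 : 0 < T / c := by positivity
    calc Real.exp (κ * (L - 2 * log 2)) / 2 * (T / c)
        = Real.exp (κ * (L - 2 * log 2)) / 2 * (T / c) * 1 := (mul_one _).symm
      _ ≤ _ := by
        have h10 := h8.le.trans h7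
        have h11 := h9.le.trans h4
        gcongr
  have hvol : volume (Metric.ball (0 : Pt) √δ) = ENNReal.ofReal (δ * π) := by
    rw [EuclideanSpace.volume_ball_fin_two, ← ENNReal.ofReal_pow (Real.sqrt_nonneg _),
      Real.sq_sqrt hδ0.le, ENNReal.ofReal_mul hδ0.le]
  have hval : T / c * π / 2 * Real.exp (-(κ * (2 * log 2))) * Real.exp ((κ - 1) * L)
      ≤ Real.exp (κ * (L - 2 * log 2)) / 2 * (T / c) * (δ * π) := by
    calc T / c * π / 2 * Real.exp (-(κ * (2 * log 2))) * Real.exp ((κ - 1) * L)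
        = Real.exp (κ * (L - 2 * log 2)) / 2 * (T / c) * (Real.exp (-L) * π) := by
          rw [show κ * (L - 2 * log 2) = -(κ * (2 * log 2)) + κ * L by ring,
            show (κ - 1) * L = κ * L + -L by ring, Real.exp_add, Real.exp_add]
          ring
      _ ≤ _ := by gcongr
  have hvpos : 0 < T / c * π / 2 * Real.exp (-(κ * (2 * log 2))) * Real.exp ((κ - 1) * L) := by
    positivity
  calc ENNReal.ofReal M
      < ENNReal.ofReal (Real.exp (κ * (L - 2 * log 2)) / 2 * (T / c) * (δ * π)) :=
        (ENNReal.ofReal_lt_ofReal_iff (hvpos.trans_le hval)).2 (hLM.trans_le hval)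
    _ = ∫⁻ _ in Metric.ball (0 : Pt) √δ,
          ENNReal.ofReal (Real.exp (κ * (L - 2 * log 2)) / 2 * (T / c)) := by
        rw [setLIntegral_const, hvol, ENNReal.ofReal_mul (by positivity)]
    _ ≤ ∫⁻ x in Metric.ball (0 : Pt) √δ,
          ENNReal.ofReal (fn lam h x (c * logProfile δ x) * logProfile δ x * dens x) :=
        setLIntegral_mono' measurableSet_ball fun x hx => ENNReal.ofReal_le_ofReal (hlow x hx)
    _ ≤ _ := lintegral_mono_set hsub

/-- The critical threshold:
`sup { c² : sup_{u ∈ H¹_R(𝔹²), ‖u‖ ≤ 1} ∫_B f(x,cu)u dv_g < ∞ } = 4π/λ`. -/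
theorem stmt13 (lam : ℝ) (h : Pt → ℝ → ℝ) (hf : CriticalGrowth lam h) :
    sSup {c2 : ℝ | ∃ c : ℝ, 0 ≤ c ∧ c2 = c ^ 2 ∧
        ∃ M : ℝ, ∀ u : Pt → ℝ, IsH1R u → enormSq u ≤ 1 →
          ∫⁻ x in B, ENNReal.ofReal (fn lam h x (c * u x) * u x * dens x)
            ≤ ENNReal.ofReal M}
      = 4 * π / lam := by
  have hlam := hf.lam_pos
  apply csSup_eq_of_forall_le_of_forall_lt_exists_gt
  · obtain ⟨M, hM⟩ := exists_lintegral_le hf le_rfl (c := 0) (by norm_num [Real.pi_pos])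
    exact ⟨0 ^ 2, 0, le_rfl, rfl, M, hM⟩
  · rintro _ ⟨c, hc, rfl, M, hM⟩
    by_contra! hcon
    rw [div_lt_iff₀ hlam, mul_comm (c ^ 2)] at hcon
    have hc0 : 0 < c := by
      rcases hc.eq_or_lt with rfl | hc0
      · have := Real.pi_pos
        norm_num at hcon
        linarith
      · exact hc0
    obtain ⟨u, hu, he, hlt⟩ := not_exists_lintegral_le hf hc0 hcon M
    exact absurd (hM u hu he) (not_le.2 hlt)
  · intro w hw
    have hpos : 0 < 4 * π / lam := by positivity
    obtain ⟨v, hv, hv4⟩ := exists_between (max_lt hw hpos)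
    have hv0 : 0 < v := (le_max_right _ _).trans_lt hv
    have hsq : √v ^ 2 = v := Real.sq_sqrt hv0.le
    rw [lt_div_iff₀ hlam] at hv4
    obtain ⟨M, hM⟩ := exists_lintegral_le hf (Real.sqrt_nonneg v) (by rw [hsq]; linarith)
    exact ⟨v, ⟨√v, Real.sqrt_nonneg v, hsq.symm, M, hM⟩, (le_max_left _ _).trans_lt hv⟩
end
end

section
/- Let f be a function of critical growth on 𝔹². Let {u_k} be a sequence of H¹_R(𝔹²)-functions and u an H¹_R(𝔹²)-function such that sup_k ‖u_k‖ < ∞, sup_k ∫_B u_k² dv_g < ∞, u_k → u almost everywhere on B (these conditions hold, up to a subsequence, when u_k converges weakly to u in H¹_R(𝔹²)), and sup_k ∫_B f(x,u_k)u_k dv_g < ∞. Then: (i) for every α ∈ (0,1), lim_{k→∞} ∫_{{|x| < α}} f(x,|u_k(x)|) dv_g = ∫_{{|x| < α}} f(x,|u(x)|) dv_g; and (ii) lim_{k→∞} ∫_B F(x,u_k(x)) dv_g = ∫_B F(x,u(x)) dv_g. -/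
open MeasureTheory Real Set Filter

noncomputable section

open scoped ENNReal Topology

theorem tendsto_lintegral_of_forall_lintegral_sub_le {α : Type*} [MeasurableSpace α]
    {μ : Measure α} {Φ : ℕ → α → ℝ≥0∞} {Φ₀ : α → ℝ≥0∞}
    (hm : ∀ k, AEMeasurable (Φ k) μ)
    (hlim : ∀ᵐ x ∂μ, Tendsto (fun k => Φ k x) atTop (𝓝 (Φ₀ x)))
    (H : ∀ ε : ℝ≥0∞, ε ≠ 0 → ∃ G : α → ℝ≥0∞, AEMeasurable G μ ∧ ∫⁻ x, G x ∂μ ≠ ∞ ∧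
      ∀ k, ∫⁻ x, (Φ k x - G x) ∂μ ≤ ε) :
    ∫⁻ x, Φ₀ x ∂μ ≠ ∞ ∧
      Tendsto (fun k => ∫⁻ x, Φ k x ∂μ) atTop (𝓝 (∫⁻ x, Φ₀ x ∂μ)) := by
  have fatou : ∫⁻ x, Φ₀ x ∂μ ≤ liminf (fun k => ∫⁻ x, Φ k x ∂μ) atTop := by
    calc ∫⁻ x, Φ₀ x ∂μ = ∫⁻ x, liminf (fun k => Φ k x) atTop ∂μ := by
          refine lintegral_congr_ae ?_
          filter_upwards [hlim] with x hx using hx.liminf_eq.symm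
      _ ≤ _ := lintegral_liminf_le' hm
  have split : ∀ (G : α → ℝ≥0∞), AEMeasurable G μ → ∀ k,
      ∫⁻ x, Φ k x ∂μ ≤ ∫⁻ x, min (Φ k x) (G x) ∂μ + ∫⁻ x, (Φ k x - G x) ∂μ := by
    intro G hG k
    rw [← lintegral_add_left' ((hm k).min hG)]
    refine lintegral_mono fun x => ?_
    rcases le_total (Φ k x) (G x) with h | h
    · simp [h]
    · simp [h, add_tsub_cancel_of_le h]
  have key : ∀ ε : ℝ≥0∞, ε ≠ 0 →
      limsup (fun k => ∫⁻ x, Φ k x ∂μ) atTop ≤ ∫⁻ x, Φ₀ x ∂μ + ε := by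
    intro ε hε
    obtain ⟨G, hG, hGi, hGk⟩ := H ε hε
    have hT : Tendsto (fun k => ∫⁻ x, min (Φ k x) (G x) ∂μ) atTop
        (𝓝 (∫⁻ x, min (Φ₀ x) (G x) ∂μ)) := by
      refine tendsto_lintegral_of_dominated_convergence' G (fun k => (hm k).min hG)
        (fun k => Eventually.of_forall fun x => min_le_right _ _) hGi ?_
      filter_upwards [hlim] with x hx using hx.min tendsto_const_nhds
    have hT' := hT.add (tendsto_const_nhds (x := ε))
    calc limsup (fun k => ∫⁻ x, Φ k x ∂μ) atTop
        ≤ limsup (fun k => ∫⁻ x, min (Φ k x) (G x) ∂μ + ε) atTop :=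
          limsup_le_limsup (Eventually.of_forall fun k =>
            (split G hG k).trans (add_le_add le_rfl (hGk k)))
      _ = ∫⁻ x, min (Φ₀ x) (G x) ∂μ + ε := hT'.limsup_eq
      _ ≤ _ := by gcongr; exact min_le_left _ _
  refine ⟨?_, ?_⟩
  · obtain ⟨G, hG, hGi, hGk⟩ := H 1 one_ne_zero
    have hb : liminf (fun k => ∫⁻ x, Φ k x ∂μ) atTop ≤ ∫⁻ x, G x ∂μ + 1 := by
      refine (liminf_le_limsup).trans (limsup_le_of_le (h := Eventually.of_forall fun k => ?_))
      refine (split G hG k).trans (add_le_add ?_ (hGk k))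
      exact lintegral_mono fun x => min_le_right _ _
    exact ((fatou.trans hb).trans_lt (ENNReal.add_lt_top.2 ⟨hGi.lt_top, ENNReal.one_lt_top⟩)).ne
  · refine tendsto_of_le_liminf_of_limsup_le fatou ?_
    refine ENNReal.le_of_forall_pos_le_add fun ε hε _ => key _ ?_
    exact_mod_cast hε.ne'

theorem tendsto_integral_of_forall_lintegral_sub_le {α : Type*} [MeasurableSpace α]
    {μ : Measure α} {φ : ℕ → α → ℝ} {φ₀ : α → ℝ}
    (hm : ∀ k, AEMeasurable (φ k) μ) (hpos : ∀ k, 0 ≤ᵐ[μ] φ k)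
    (hlim : ∀ᵐ x ∂μ, Tendsto (fun k => φ k x) atTop (𝓝 (φ₀ x)))
    (H : ∀ ε : ℝ, 0 < ε → ∃ G : α → ℝ, (∀ x, 0 ≤ G x) ∧ Integrable G μ ∧
      ∀ k, ∫⁻ x, ENNReal.ofReal (φ k x - G x) ∂μ ≤ ENNReal.ofReal ε) :
    Tendsto (fun k => ∫ x, φ k x ∂μ) atTop (𝓝 (∫ x, φ₀ x ∂μ)) := by
  have hpos0 : 0 ≤ᵐ[μ] φ₀ := by
    filter_upwards [hlim, ae_all_iff.2 hpos] with x hx hp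
    exact ge_of_tendsto' hx hp
  have hm0 : AEMeasurable φ₀ μ := aemeasurable_of_tendsto_metrizable_ae atTop hm hlim
  have main := tendsto_lintegral_of_forall_lintegral_sub_le (μ := μ)
    (Φ := fun k x => ENNReal.ofReal (φ k x)) (Φ₀ := fun x => ENNReal.ofReal (φ₀ x))
    (fun k => (hm k).ennreal_ofReal)
    (by filter_upwards [hlim] with x hx using (ENNReal.continuous_ofReal.tendsto _).comp hx)
    (by
      intro ε hε
      obtain ⟨ε', h0, h1⟩ : ∃ ε' : ℝ, 0 < ε' ∧ ENNReal.ofReal ε' ≤ ε := by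
        obtain ⟨r, hr0, hr⟩ := ENNReal.lt_iff_exists_nnreal_btwn.1 (pos_iff_ne_zero.2 hε)
        exact ⟨r, by exact_mod_cast hr0, by simpa using hr.le⟩
      obtain ⟨G, hG0, hG, hGk⟩ := H ε' h0
      refine ⟨fun x => ENNReal.ofReal (G x), hG.aemeasurable.ennreal_ofReal,
        hG.lintegral_lt_top.ne, fun k => le_trans (le_of_eq ?_) ((hGk k).trans h1)⟩
      exact lintegral_congr fun x => (ENNReal.ofReal_sub _ (hG0 x)).symm)
  rw [integral_eq_lintegral_of_nonneg_ae hpos0 hm0.aestronglyMeasurable]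
  simp_rw [fun k => integral_eq_lintegral_of_nonneg_ae (hpos k) (hm k).aestronglyMeasurable]
  exact (ENNReal.tendsto_toReal main.1).comp main.2

theorem setIntegral_B_comp_norm (f : ℝ → ℝ) :
    ∫ x in B, f ‖x‖ = 2 * volume.real B * ∫ y in Ioo (0 : ℝ) 1, y * f y := by
  have hdim : Module.finrank ℝ Pt = 2 := by simp
  have key := integral_fun_norm_addHaar (E := Pt) volume (indicator (Iio 1) f)
  have e1 : ∫ x : Pt, indicator (Iio 1) f ‖x‖ = ∫ x in B, f ‖x‖ := by
    rw [← integral_indicator (by exact measurableSet_ball)]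
    congr 1
    ext x
    by_cases hx : ‖x‖ < 1 <;> simp [B, indicator, hx]
  have e2 : ∫ y in Ioi (0 : ℝ), y ^ (2 - 1) • indicator (Iio 1) f y
      = ∫ y in Ioo (0 : ℝ) 1, y * f y := by
    rw [← integral_indicator measurableSet_Ioi, ← integral_indicator measurableSet_Ioo]
    congr 1
    ext y
    by_cases h0 : 0 < y <;> by_cases h1 : y < 1 <;> simp [indicator, h0, h1]
  rw [e1, hdim, e2] at key
  rw [key]
  simp [B, mul_assoc]

theorem integrableOn_B_comp_norm {f : ℝ → ℝ} :
    IntegrableOn (fun x : Pt => f ‖x‖) B ↔ IntegrableOn (fun y => y * f y) (Ioo (0 : ℝ) 1) := by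
  have := integrableOn_fun_norm_addHaar (E := Pt) volume (f := f) (r := 1)
  simpa [B] using this

theorem volume_real_B_pos : 0 < volume.real B :=
  ENNReal.toReal_pos (Metric.measure_ball_pos volume (0 : Pt) one_pos).ne'
    measure_ball_lt_top.ne

theorem abs_le_mul_sqrt_of_integral_bounds {v v' : ℝ → ℝ} {K₁ K₂ : ℝ}
    (hderiv : ∀ r ∈ Ioo (0 : ℝ) 1, HasDerivAt v (v' r) r) (hmeas : Measurable v')
    (hi₁ : IntegrableOn (fun y => y * v' y ^ 2) (Ioo (0 : ℝ) 1))
    (hK₁ : ∫ y in Ioo (0 : ℝ) 1, y * v' y ^ 2 ≤ K₁)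
    (hi₂ : IntegrableOn (fun y => y * (v y ^ 2 * (2 / (1 - y ^ 2)) ^ 2)) (Ioo (0 : ℝ) 1))
    (hK₂ : ∫ y in Ioo (0 : ℝ) 1, y * (v y ^ 2 * (2 / (1 - y ^ 2)) ^ 2) ≤ K₂)
    {r : ℝ} (hr : 1 / 2 ≤ r) (hr1 : r < 1) :
    |v r| ≤ (2 * K₁ + 1 + √(8 * K₂)) * √(1 - r) := by
  set d := √(1 - r) with hd
  have hδ : 0 < 1 - r := by linarith
  have hd0 : 0 < d := Real.sqrt_pos.2 hδ
  have hd2 : d ^ 2 = 1 - r := Real.sq_sqrt hδ.le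
  have hK₁0 : 0 ≤ K₁ := by
    refine le_trans (setIntegral_nonneg measurableSet_Ioo fun y hy => ?_) hK₁
    exact mul_nonneg hy.1.le (sq_nonneg _)
  have hosc : ∀ s, r ≤ s → s < 1 → |v s - v r| ≤ d * (K₁ + 1 / 2) := by
    intro s hrs hs1
    have hsub : Ioc r s ⊆ Ioo (0 : ℝ) 1 := fun y hy => ⟨by linarith [hy.1], by linarith [hy.2]⟩
    have hpt : ∀ y ∈ Ioc r s, ‖v' y‖ ≤ d * (y * v' y ^ 2) + 1 / (2 * d) := by
      intro y hy
      have hy2 : 1 / 2 ≤ y := by linarith [hy.1]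
      have h1 : |v' y| ≤ d * (1 / 2 * v' y ^ 2) + 1 / (2 * d) := by
        have : 0 ≤ (d * |v' y| - 1) ^ 2 / (2 * d) := by positivity
        have e : (d * |v' y| - 1) ^ 2 / (2 * d)
            = d * (1 / 2 * |v' y| ^ 2) + 1 / (2 * d) - |v' y| := by
          field_simp
          ring
        rw [e, sq_abs] at this
        linarith
      have h2 : d * (1 / 2 * v' y ^ 2) ≤ d * (y * v' y ^ 2) := by gcongr
      rw [Real.norm_eq_abs]
      linarith
    have hgi : IntegrableOn (fun y => d * (y * v' y ^ 2) + 1 / (2 * d)) (Ioc r s) :=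
      ((hi₁.mono_set hsub).const_mul d).add (integrableOn_const (by simp))
    have hv'i : IntervalIntegrable v' volume r s := by
      rw [intervalIntegrable_iff_integrableOn_Ioc_of_le hrs]
      refine Integrable.mono' hgi hmeas.aestronglyMeasurable ?_
      exact (ae_restrict_iff' measurableSet_Ioc).2 (Eventually.of_forall hpt)
    have hftc : ∫ y in r..s, v' y = v s - v r := by
      refine intervalIntegral.integral_eq_sub_of_hasDerivAt (fun y hy => hderiv y ?_) hv'i
      rw [uIcc_of_le hrs] at hy
      exact ⟨by linarith [hy.1], by linarith [hy.2]⟩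
    rw [← hftc, ← Real.norm_eq_abs]
    calc ‖∫ y in r..s, v' y‖ ≤ ∫ y in r..s, (d * (y * v' y ^ 2) + 1 / (2 * d)) := by
          refine intervalIntegral.norm_integral_le_of_norm_le hrs
            (Eventually.of_forall hpt) ?_
          rwa [intervalIntegrable_iff_integrableOn_Ioc_of_le hrs]
      _ = d * (∫ y in Ioc r s, y * v' y ^ 2) + (s - r) * (1 / (2 * d)) := by
          rw [intervalIntegral.integral_of_le hrs,
            integral_add ((hi₁.mono_set hsub).const_mul d) (integrableOn_const (by simp)),
            integral_const_mul]
          simp [hrs]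
      _ ≤ d * K₁ + d ^ 2 * (1 / (2 * d)) := by
          have : ∫ y in Ioc r s, y * v' y ^ 2 ≤ K₁ := by
            refine le_trans (setIntegral_mono_set hi₁ ?_ hsub.eventuallyLE) hK₁
            exact (ae_restrict_iff' measurableSet_Ioo).2
              (Eventually.of_forall fun y hy => mul_nonneg hy.1.le (sq_nonneg _))
          gcongr
          rw [hd2]; linarith
      _ = d * (K₁ + 1 / 2) := by field_simp
  by_cases hcase : |v r| ≤ 2 * (d * (K₁ + 1 / 2))
  · have : 0 ≤ √(8 * K₂) * d := by positivity
    nlinarith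
  · push Not at hcase
    have hlow : ∀ s ∈ Ioo r 1, |v r| / 2 ≤ |v s| := by
      intro s hs
      have h1 := hosc s hs.1.le hs.2
      have h2 := abs_sub_abs_le_abs_sub (v r) (v s)
      rw [abs_sub_comm] at h2
      linarith
    have hpt : ∀ s ∈ Ioo r 1, 1 / 2 * ((v r ^ 2 / 4) * (1 / (1 - r) ^ 2))
        ≤ s * (v s ^ 2 * (2 / (1 - s ^ 2)) ^ 2) := by
      intro s hs
      have hs1 : 0 < 1 - s := by linarith [hs.2]
      have h1 : v r ^ 2 / 4 ≤ v s ^ 2 := by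
        have := pow_le_pow_left₀ (by positivity) (hlow s hs) 2
        rw [div_pow, sq_abs, sq_abs] at this
        linarith
      have h2 : 1 / (1 - r) ^ 2 ≤ (2 / (1 - s ^ 2)) ^ 2 := by
        rw [← one_div_pow]
        refine pow_le_pow_left₀ (by positivity) ?_ 2
        rw [div_le_div_iff₀ hδ (by nlinarith [hs.1])]
        nlinarith [hs.1]
      have h3 : 1 / 2 ≤ s := by linarith [hs.1]
      gcongr
    have hsub : Ioo r 1 ⊆ Ioo (0 : ℝ) 1 := fun y hy => ⟨by linarith [hy.1], hy.2⟩
    have hbig : (1 - r) * (1 / 2 * ((v r ^ 2 / 4) * (1 / (1 - r) ^ 2))) ≤ K₂ := by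
      calc (1 - r) * (1 / 2 * ((v r ^ 2 / 4) * (1 / (1 - r) ^ 2)))
          = ∫ _s in Ioo r 1, (1 / 2 * ((v r ^ 2 / 4) * (1 / (1 - r) ^ 2))) := by
            simp [hr1.le]
        _ ≤ ∫ s in Ioo r 1, s * (v s ^ 2 * (2 / (1 - s ^ 2)) ^ 2) :=
            setIntegral_mono_on (integrableOn_const (by simp)) (hi₂.mono_set hsub)
              measurableSet_Ioo hpt
        _ ≤ ∫ s in Ioo (0 : ℝ) 1, s * (v s ^ 2 * (2 / (1 - s ^ 2)) ^ 2) := by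
            refine setIntegral_mono_set hi₂ ?_ hsub.eventuallyLE
            exact (ae_restrict_iff' measurableSet_Ioo).2
              (Eventually.of_forall fun y hy => mul_nonneg hy.1.le (by positivity))
        _ ≤ K₂ := hK₂
    have hsq : v r ^ 2 ≤ 8 * K₂ * (1 - r) := by
      have e : (1 - r) * (1 / 2 * ((v r ^ 2 / 4) * (1 / (1 - r) ^ 2)))
          = v r ^ 2 / (8 * (1 - r)) := by
        field_simp
        ring
      rw [e, div_le_iff₀ (by positivity)] at hbig
      linarith
    have h1 : |v r| ≤ √(8 * K₂) * d := by
      rw [hd, ← Real.sqrt_mul' _ hδ.le]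
      exact Real.abs_le_sqrt hsq
    have h2 : 0 ≤ (2 * K₁ + 1) * d := by positivity
    linarith

theorem IsH1R.hasDerivAt_radial {u : Pt → ℝ} (hu : IsH1R u) {e n : Pt} (he : ‖e‖ = 1)
    (hn : ‖n‖ = 1) {r : ℝ} (hr : |r| < 1) :
    HasDerivAt (fun s : ℝ => u (s • e)) (fderiv ℝ u (r • n) n) r := by
  have heq : (fun s : ℝ => u (s • e)) = fun s : ℝ => u (s • n) := by
    funext s
    exact hu.2 _ _ (by simp [norm_smul, he, hn])
  rw [heq]
  have hmem : r • n ∈ B := by simpa [B, norm_smul, hn] using hr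
  have hd : DifferentiableAt ℝ u (r • n) :=
    (hu.1.1 _ hmem).differentiableAt (Metric.isOpen_ball.mem_nhds hmem)
  have hline : HasDerivAt (fun s : ℝ => s • n) n r := by
    simpa using (hasDerivAt_id r).smul_const n
  exact hd.hasFDerivAt.comp_hasDerivAt r hline

theorem IsH1R.abs_le_mul_sqrt {u : Pt → ℝ} (hu : IsH1R u) {M₁ M₂ : ℝ}
    (h₁ : enormSq u ≤ M₁) (h₂ : hInt (fun x => u x ^ 2) ≤ M₂)
    {x : Pt} (hx : 1 / 2 ≤ ‖x‖) (hx1 : ‖x‖ < 1) :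
    |u x| ≤ (2 * (M₁ / (2 * volume.real B)) + 1 + √(8 * (M₂ / (2 * volume.real B))))
      * √(1 - ‖x‖) := by
  obtain ⟨e, he⟩ : ∃ e : Pt, ‖e‖ = 1 := ⟨EuclideanSpace.single 0 1, by simp⟩
  set v : ℝ → ℝ := fun s => u (s • e) with hv
  have huv : ∀ y : Pt, u y = v ‖y‖ := fun y => hu.2 _ _ (by simp [norm_smul, he])
  have hV := volume_real_B_pos
  have hmeas : Measurable (deriv v) := measurable_deriv v
  have hgrad : ∀ y ∈ B, deriv v ‖y‖ ^ 2 ≤ ‖gradient u y‖ ^ 2 := by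
    intro y hy
    obtain ⟨n, hn, hyn⟩ : ∃ n : Pt, ‖n‖ = 1 ∧ ‖y‖ • n = y := by
      by_cases h0 : y = 0
      · exact ⟨e, he, by simp [h0]⟩
      · have h0' : ‖y‖ ≠ 0 := norm_ne_zero_iff.2 h0
        exact ⟨‖y‖⁻¹ • y, by simp [norm_smul, h0'], by rw [smul_smul, mul_inv_cancel₀ h0', one_smul]⟩
    have hy1 : |‖y‖| < 1 := by simpa [B] using hy
    have := (hu.hasDerivAt_radial he hn hy1).deriv
    rw [hv, this, hyn, ← sq_abs]
    refine pow_le_pow_left₀ (abs_nonneg _) ?_ 2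
    calc |fderiv ℝ u y n| ≤ ‖fderiv ℝ u y‖ * ‖n‖ := (fderiv ℝ u y).le_opNorm n
      _ = ‖gradient u y‖ := by simp [gradient, hn]
  have hBm : MeasurableSet B := measurableSet_ball
  have hi₁ : IntegrableOn (fun y : Pt => deriv v ‖y‖ ^ 2) B := by
    refine Integrable.mono' hu.1.2.1
      ((hmeas.comp measurable_norm).pow_const 2).aestronglyMeasurable ?_
    refine (ae_restrict_iff' hBm).2 (Eventually.of_forall fun y hy => ?_)
    simpa using hgrad y hy
  have hi₂ : IntegrableOn (fun y : Pt => v ‖y‖ ^ 2 * (2 / (1 - ‖y‖ ^ 2)) ^ 2) B := by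
    have := hu.1.2.2
    unfold HIntegrable dens at this
    simpa only [huv] using this
  have hK₁ : ∫ y in B, deriv v ‖y‖ ^ 2 ≤ M₁ :=
    (setIntegral_mono_on hi₁ hu.1.2.1 hBm hgrad).trans h₁
  have hK₂ : ∫ y in B, v ‖y‖ ^ 2 * (2 / (1 - ‖y‖ ^ 2)) ^ 2 ≤ M₂ := by
    unfold hInt dens at h₂
    simpa only [huv] using h₂
  rw [huv]
  rw [setIntegral_B_comp_norm (fun y => deriv v y ^ 2)] at hK₁
  rw [setIntegral_B_comp_norm (fun y => v y ^ 2 * (2 / (1 - y ^ 2)) ^ 2)] at hK₂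
  refine abs_le_mul_sqrt_of_integral_bounds (v' := deriv v) (fun r hr => ?_) hmeas
    (integrableOn_B_comp_norm.1 hi₁) ?_
    (integrableOn_B_comp_norm (f := fun y => v y ^ 2 * (2 / (1 - y ^ 2)) ^ 2).1 hi₂) ?_ hx hx1
  · refine (hu.hasDerivAt_radial he he ?_).differentiableAt.hasDerivAt
    rw [abs_of_pos hr.1]
    exact hr.2
  · rw [le_div_iff₀ (by positivity)]; linarith
  · rw [le_div_iff₀ (by positivity)]; linarith

theorem dens_nonneg (x : Pt) : 0 ≤ dens x := sq_nonneg _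

theorem measurable_dens : Measurable dens := by
  unfold dens
  fun_prop

theorem integrableOn_dens_ball {α : ℝ} (h0 : 0 < α) (h1 : α < 1) :
    IntegrableOn dens (Metric.ball 0 α) := by
  refine Measure.integrableOn_of_bounded (M := (2 / (1 - α ^ 2)) ^ 2) measure_ball_lt_top.ne
    measurable_dens.aestronglyMeasurable ?_
  refine (ae_restrict_iff' measurableSet_ball).2 (Eventually.of_forall fun x hx => ?_)
  have hx' : ‖x‖ < α := by simpa using hx
  rw [Real.norm_of_nonneg (dens_nonneg x)]
  have h2 : 0 < 1 - α ^ 2 := by nlinarith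
  have h3 : ‖x‖ ^ 2 ≤ α ^ 2 := by gcongr
  have h4 : 0 ≤ 2 / (1 - ‖x‖ ^ 2) := div_nonneg (by norm_num) (by linarith)
  unfold dens
  gcongr

section Nonlinearity

variable {lam : ℝ} {h : Pt → ℝ → ℝ}

theorem CriticalGrowth.continuous_fn (hf : CriticalGrowth lam h) :
    Continuous (Function.uncurry (fn lam h)) := by
  have := hf.h_C1.continuous
  have e : Function.uncurry (fn lam h)
      = fun p => Function.uncurry h p * (Real.exp (lam * p.2 ^ 2) - 1) := rfl
  rw [e]
  fun_prop

theorem CriticalGrowth.continuous_Fn (hf : CriticalGrowth lam h) :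
    Continuous (Function.uncurry (Fn lam h)) :=
  intervalIntegral.continuous_parametric_primitive_of_continuous hf.continuous_fn

theorem CriticalGrowth.fn_abs_nonneg (hf : CriticalGrowth lam h) {x : Pt} (hx : x ∈ B) (t : ℝ) :
    0 ≤ fn lam h x |t| := by
  rcases (abs_nonneg t).eq_or_lt with h0 | h0
  · simp [← h0, fn]
  · exact (hf.f_pos x hx _ h0).le

theorem CriticalGrowth.fn_mul_self (hf : CriticalGrowth lam h) {x : Pt} (hx : x ∈ B) (t : ℝ) :
    fn lam h x t * t = fn lam h x |t| * |t| := by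
  rcases abs_choice t with h0 | h0
  · rw [h0]
  · rw [h0, hf.f_odd x hx]; ring

theorem CriticalGrowth.Fn_abs (hf : CriticalGrowth lam h) {x : Pt} (hx : x ∈ B) (t : ℝ) :
    Fn lam h x |t| = Fn lam h x t := by
  rcases abs_choice t with h0 | h0
  · rw [h0]
  · rw [h0]
    unfold Fn
    have := intervalIntegral.integral_comp_neg (a := 0) (b := t) (fun s => fn lam h x s)
    simp only [neg_zero] at this
    rw [intervalIntegral.integral_symm, ← this, ← intervalIntegral.integral_neg]
    simp [hf.f_odd x hx]

theorem CriticalGrowth.Fn_nonneg (hf : CriticalGrowth lam h) {x : Pt} (hx : x ∈ B) (t : ℝ) :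
    0 ≤ Fn lam h x t := by
  rw [← hf.Fn_abs hx]
  refine intervalIntegral.integral_nonneg (abs_nonneg t) fun s hs => ?_
  have := hf.fn_abs_nonneg hx s
  rwa [abs_of_nonneg hs.1] at this

theorem CriticalGrowth.exists_abs_fn_le (hf : CriticalGrowth lam h) {L : ℝ} (hL : 0 < L) :
    ∃ C : ℝ, 0 ≤ C ∧ ∀ x ∈ B, ∀ t : ℝ, |t| ≤ L → |fn lam h x t| ≤ C * t ^ 2 := by
  obtain ⟨C, hC⟩ := hf.h_bdd L hL
  have hlam := hf.lam_pos
  refine ⟨|C| * (lam * Real.exp (lam * L ^ 2)), by positivity, fun x hx t ht => ?_⟩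
  have h1 : |h x t| ≤ |C| := (hC x hx t ht).trans (le_abs_self C)
  have h2 : t ^ 2 ≤ L ^ 2 := sq_le_sq' (by linarith [neg_le_of_abs_le ht]) (le_of_abs_le ht)
  have h3 : |Real.exp (lam * t ^ 2) - 1| ≤ lam * Real.exp (lam * L ^ 2) * t ^ 2 := by
    set y := lam * t ^ 2 with hy
    have hy0 : 0 ≤ y := by positivity
    rw [abs_of_nonneg (by linarith [Real.one_le_exp hy0])]
    have h4 : Real.exp y - 1 ≤ y * Real.exp y := by
      have := Real.add_one_le_exp (-y)
      have h5 : Real.exp (-y) * Real.exp y = 1 := by rw [← Real.exp_add]; simp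
      nlinarith [Real.exp_pos y]
    have h6 : Real.exp y ≤ Real.exp (lam * L ^ 2) := Real.exp_le_exp.2 (by rw [hy]; gcongr)
    calc Real.exp y - 1 ≤ y * Real.exp y := h4
      _ ≤ y * Real.exp (lam * L ^ 2) := by gcongr
      _ = _ := by rw [hy]; ring
  unfold fn
  rw [abs_mul]
  calc |h x t| * |Real.exp (lam * t ^ 2) - 1|
      ≤ |C| * (lam * Real.exp (lam * L ^ 2) * t ^ 2) := by gcongr
    _ = _ := by ring

theorem CriticalGrowth.exists_Fn_le (hf : CriticalGrowth lam h) :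
    ∃ C : ℝ, 0 ≤ C ∧ ∀ x ∈ B, ∀ t : ℝ, |t| ≤ 1 → Fn lam h x t ≤ C * |t| * t ^ 2 := by
  obtain ⟨C, hC0, hC⟩ := hf.exists_abs_fn_le one_pos
  refine ⟨C, hC0, fun x hx t ht => ?_⟩
  rw [← hf.Fn_abs hx]
  have := intervalIntegral.norm_integral_le_of_norm_le_const (a := 0) (b := |t|)
    (f := fun s => fn lam h x s) (C := C * t ^ 2) (fun s hs => ?_)
  · rw [sub_zero, abs_abs] at this
    calc Fn lam h x |t| ≤ ‖Fn lam h x |t|‖ := le_abs_self _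
      _ ≤ C * t ^ 2 * |t| := this
      _ = _ := by ring
  · rw [uIoc_of_le (abs_nonneg t)] at hs
    have hs2 : s ^ 2 ≤ t ^ 2 := by
      rw [← sq_abs t]
      exact pow_le_pow_left₀ hs.1.le hs.2 2
    calc ‖fn lam h x s‖ ≤ C * s ^ 2 :=
          hC x hx s (by rw [abs_of_pos hs.1]; linarith [hs.2])
      _ ≤ C * t ^ 2 := by gcongr

theorem CriticalGrowth.exists_fn_abs_le (hf : CriticalGrowth lam h) {L : ℝ} (hL : 0 < L) :
    ∃ C : ℝ, 0 ≤ C ∧ ∀ x ∈ B, ∀ t : ℝ,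
      fn lam h x |t| ≤ C + L⁻¹ * (fn lam h x t * t) := by
  obtain ⟨C, hC0, hC⟩ := hf.exists_abs_fn_le hL
  refine ⟨C * L ^ 2, by positivity, fun x hx t => ?_⟩
  have hpos := hf.fn_abs_nonneg hx t
  rw [hf.fn_mul_self hx]
  rcases le_total |t| L with ht | ht
  · have h1 := (le_abs_self _).trans (hC x hx |t| (by rwa [abs_abs]))
    have h2 : C * |t| ^ 2 ≤ C * L ^ 2 := by gcongr
    have h3 : 0 ≤ L⁻¹ * (fn lam h x |t| * |t|) := by positivity
    linarith
  · have h1 : fn lam h x |t| ≤ L⁻¹ * (fn lam h x |t| * |t|) := by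
      rw [le_inv_mul_iff₀ hL, mul_comm]
      gcongr
    have : 0 ≤ C * L ^ 2 := by positivity
    linarith

end Nonlinearity

theorem lintegral_ofReal_const_mul_le {α : Type*} [MeasurableSpace α] {μ : Measure α}
    {φ : α → ℝ} {c M : ℝ} (hc : 0 ≤ c)
    (hφ : ∫⁻ x, ENNReal.ofReal (φ x) ∂μ ≤ ENNReal.ofReal M) :
    ∫⁻ x, ENNReal.ofReal (c * φ x) ∂μ ≤ ENNReal.ofReal (c * M) := by
  simp_rw [ENNReal.ofReal_mul hc]
  rw [lintegral_const_mul' _ _ ENNReal.ofReal_ne_top]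
  gcongr

section Convergence

variable {lam : ℝ} {h : Pt → ℝ → ℝ} {u : ℕ → Pt → ℝ} {u₀ : Pt → ℝ} {M : ℝ}

theorem tendsto_setIntegral_fn_abs (hf : CriticalGrowth lam h) (huk : ∀ k, IsH1R (u k))
    (hae : ∀ᵐ x ∂(volume.restrict B), Tendsto (fun k => u k x) atTop (𝓝 (u₀ x)))
    (hM0 : 0 ≤ M)
    (hM : ∀ k, ∫⁻ x in B, ENNReal.ofReal (fn lam h x (u k x) * u k x * dens x)
      ≤ ENNReal.ofReal M) {α : ℝ} (hα : α ∈ Ioo (0 : ℝ) 1) :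
    Tendsto (fun k => ∫ x in Metric.ball 0 α, fn lam h x |u k x| * dens x) atTop
      (𝓝 (∫ x in Metric.ball 0 α, fn lam h x |u₀ x| * dens x)) := by
  have hsub : Metric.ball (0 : Pt) α ⊆ B := Metric.ball_subset_ball hα.2.le
  have hcont := hf.continuous_fn
  refine tendsto_integral_of_forall_lintegral_sub_le (fun k => ?_) (fun k => ?_) ?_ ?_
  · have hu : ContinuousOn (u k) (Metric.ball 0 α) := (huk k).1.1.continuousOn.mono hsub
    have : ContinuousOn (fun x => fn lam h x |u k x|) (Metric.ball 0 α) :=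
      hcont.comp_continuousOn (continuousOn_id.prodMk hu.abs)
    exact (this.aemeasurable measurableSet_ball).mul measurable_dens.aemeasurable
  · refine (ae_restrict_iff' measurableSet_ball).2 (Eventually.of_forall fun x hx => ?_)
    exact mul_nonneg (hf.fn_abs_nonneg (hsub hx) _) (dens_nonneg x)
  · filter_upwards [ae_mono (Measure.restrict_mono hsub le_rfl) hae] with x hx
    have : Tendsto (fun k => fn lam h x |u k x|) atTop (𝓝 (fn lam h x |u₀ x|)) :=
      (hcont.tendsto (x, |u₀ x|)).comp (tendsto_const_nhds.prodMk_nhds hx.abs)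
    exact this.mul_const _
  · intro ε hε
    obtain ⟨C, hC0, hC⟩ := hf.exists_fn_abs_le (L := M / ε + 1) (by positivity)
    refine ⟨fun x => C * dens x, fun x => mul_nonneg hC0 (dens_nonneg x),
      (integrableOn_dens_ball hα.1 hα.2).const_mul C, fun k => ?_⟩
    calc ∫⁻ x in Metric.ball 0 α, ENNReal.ofReal (fn lam h x |u k x| * dens x - C * dens x)
        ≤ ∫⁻ x in Metric.ball 0 α, ENNReal.ofReal
            ((M / ε + 1)⁻¹ * (fn lam h x (u k x) * u k x * dens x)) := by
          refine setLIntegral_mono' measurableSet_ball fun x hx => ENNReal.ofReal_le_ofReal ?_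
          have := mul_le_mul_of_nonneg_right (hC x (hsub hx) (u k x)) (dens_nonneg x)
          linarith
      _ ≤ ENNReal.ofReal ((M / ε + 1)⁻¹ * M) :=
          lintegral_ofReal_const_mul_le (by positivity)
            ((lintegral_mono_set hsub).trans (hM k))
      _ ≤ ENNReal.ofReal ε := by
          refine ENNReal.ofReal_le_ofReal ?_
          rw [inv_mul_le_iff₀ (by positivity)]
          field_simp
          linarith

theorem tendsto_hInt_Fn (hf : CriticalGrowth lam h) (huk : ∀ k, IsH1R (u k))
    (hae : ∀ᵐ x ∂(volume.restrict B), Tendsto (fun k => u k x) atTop (𝓝 (u₀ x)))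
    (hM0 : 0 ≤ M)
    (hM : ∀ k, ∫⁻ x in B, ENNReal.ofReal (fn lam h x (u k x) * u k x * dens x)
      ≤ ENNReal.ofReal M)
    {M₂ D : ℝ} (hM₂ : ∀ k, hInt (fun x => u k x ^ 2) ≤ M₂) (hD0 : 0 ≤ D)
    (hD : ∀ k x, 1 / 2 ≤ ‖x‖ → ‖x‖ < 1 → |u k x| ≤ D * √(1 - ‖x‖)) :
    Tendsto (fun k => hInt (fun x => Fn lam h x (u k x))) atTop
      (𝓝 (hInt (fun x => Fn lam h x (u₀ x)))) := by
  have hcont := hf.continuous_Fn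
  have hBm : MeasurableSet B := measurableSet_ball
  have hM₂0 : 0 ≤ M₂ := (integral_nonneg fun x =>
    mul_nonneg (sq_nonneg (u 0 x)) (dens_nonneg x)).trans (hM₂ 0)
  refine tendsto_integral_of_forall_lintegral_sub_le (fun k => ?_) (fun k => ?_) ?_ ?_
  · have : ContinuousOn (fun x => Fn lam h x (u k x)) B :=
      hcont.comp_continuousOn (continuousOn_id.prodMk (huk k).1.1.continuousOn)
    exact (this.aemeasurable hBm).mul measurable_dens.aemeasurable
  · refine (ae_restrict_iff' hBm).2 (Eventually.of_forall fun x hx => ?_)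
    exact mul_nonneg (hf.Fn_nonneg hx _) (dens_nonneg x)
  · filter_upwards [hae] with x hx
    have : Tendsto (fun k => Fn lam h x (u k x)) atTop (𝓝 (Fn lam h x (u₀ x))) :=
      (hcont.tendsto (x, u₀ x)).comp (tendsto_const_nhds.prodMk_nhds hx)
    exact this.mul_const _
  · intro ε hε
    obtain ⟨M₁, hM₁, g, hg0, hgi, hFb⟩ := hf.F_bound
    obtain ⟨K, hK0, hK⟩ := hf.exists_Fn_le
    set L : ℝ := 2 * M₁ * M / ε + 1 with hL
    have hL0 : 0 < L := by positivity
    obtain ⟨C, hC0, hC⟩ := hf.exists_fn_abs_le hL0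
    set η : ℝ := min 1 (ε / (2 * (K * M₂ + 1))) with hη
    have hη0 : 0 < η := lt_min one_pos (by positivity)
    have hηε : K * η * M₂ ≤ ε / 2 := by
      have h1 : η ≤ ε / (2 * (K * M₂ + 1)) := min_le_right _ _
      rw [le_div_iff₀ (by positivity)] at h1
      nlinarith
    obtain ⟨α, hα, hα1, hαη⟩ : ∃ α : ℝ, 1 / 2 < α ∧ α < 1 ∧ D * √(1 - α) ≤ η := by
      have ht : Tendsto (fun a : ℝ => D * √(1 - a)) (𝓝[<] 1) (𝓝 0) := by
        have : Continuous fun a : ℝ => D * √(1 - a) := by fun_prop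
        have h2 := this.tendsto 1
        simp only [sub_self, Real.sqrt_zero, mul_zero] at h2
        exact h2.mono_left nhdsWithin_le_nhds
      obtain ⟨a, h1, h2⟩ := ((ht.eventually_lt_const hη0).and
        (Ioo_mem_nhdsLT (show (1 / 2 : ℝ) < 1 by norm_num))).exists
      exact ⟨a, h2.1, h2.2, h1.le⟩
    have hball : MeasurableSet (Metric.ball (0 : Pt) α) := measurableSet_ball
    refine ⟨fun x => M₁ * (g x * dens x) + M₁ * C * (Metric.ball 0 α).indicator dens x,
      fun x => ?_, ?_, fun k => ?_⟩
    · have h1 := mul_nonneg (hg0 x) (dens_nonneg x)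
      have h2 : 0 ≤ (Metric.ball 0 α).indicator dens x :=
        indicator_nonneg (fun y _ => dens_nonneg y) x
      positivity
    · refine (hgi.const_mul M₁).add (Integrable.const_mul ?_ _)
      exact ((integrable_indicator_iff hball).2
        (integrableOn_dens_ball (by linarith) hα1)).integrableOn
    · have hpt : ∀ x ∈ B, Fn lam h x (u k x) * dens x
          - (M₁ * (g x * dens x) + M₁ * C * (Metric.ball 0 α).indicator dens x)
          ≤ M₁ * L⁻¹ * (fn lam h x (u k x) * u k x * dens x)
            + K * η * (u k x ^ 2 * dens x) := by
        intro x hx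
        have hd := dens_nonneg x
        have hgd := mul_nonneg (hg0 x) hd
        have hfu : 0 ≤ fn lam h x (u k x) * u k x * dens x := by
          rw [hf.fn_mul_self hx]
          exact mul_nonneg (mul_nonneg (hf.fn_abs_nonneg hx _) (abs_nonneg _)) hd
        by_cases hxα : ‖x‖ < α
        · have hF : Fn lam h x (u k x) ≤ M₁ * (g x + fn lam h x |u k x|) := by
            rw [← hf.Fn_abs hx]
            rcases (abs_nonneg (u k x)).eq_or_lt with h0 | h0
            · have := hg0 x
              simp only [← h0, Fn, fn, intervalIntegral.integral_same]
              simp only [ne_eq, OfNat.ofNat_ne_zero, not_false_eq_true, zero_pow, mul_zero,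
                Real.exp_zero, sub_self, add_zero]
              positivity
            · exact hFb x hx _ h0
          have h1 : Fn lam h x (u k x)
              ≤ M₁ * (g x + (C + L⁻¹ * (fn lam h x (u k x) * u k x))) := by
            refine hF.trans ?_
            have := hC x hx (u k x)
            gcongr
          have h2 := mul_le_mul_of_nonneg_right h1 hd
          have h3 : 0 ≤ K * η * (u k x ^ 2 * dens x) := by positivity
          rw [indicator_of_mem (by simpa using hxα)]
          linarith
        · rw [indicator_of_notMem (by simpa using hxα)]
          push Not at hxα
          have hx1 : ‖x‖ < 1 := by simpa [B] using hx
          have hu1 : |u k x| ≤ η := by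
            refine (hD k x (by linarith) hx1).trans (le_trans ?_ hαη)
            gcongr
          have h1 : Fn lam h x (u k x) ≤ K * η * u k x ^ 2 := by
            refine (hK x hx _ (hu1.trans (min_le_left _ _))).trans ?_
            gcongr
          have h2 := mul_le_mul_of_nonneg_right h1 hd
          have h3 : 0 ≤ M₁ * L⁻¹ * (fn lam h x (u k x) * u k x * dens x) := by positivity
          have h4 := mul_nonneg hM₁.le hgd
          linarith
      have hi : Integrable (fun x => u k x ^ 2 * dens x) (volume.restrict B) := (huk k).1.2.2
      have hsq : ∫⁻ x in B, ENNReal.ofReal (u k x ^ 2 * dens x) ≤ ENNReal.ofReal M₂ := by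
        rw [← ofReal_integral_eq_lintegral_ofReal hi
          (Eventually.of_forall fun x => mul_nonneg (sq_nonneg _) (dens_nonneg x))]
        exact ENNReal.ofReal_le_ofReal (hM₂ k)
      calc ∫⁻ x in B, ENNReal.ofReal (Fn lam h x (u k x) * dens x
            - (M₁ * (g x * dens x) + M₁ * C * (Metric.ball 0 α).indicator dens x))
          ≤ ∫⁻ x in B, (ENNReal.ofReal (M₁ * L⁻¹ * (fn lam h x (u k x) * u k x * dens x))
            + ENNReal.ofReal (K * η * (u k x ^ 2 * dens x))) :=
            setLIntegral_mono' hBm fun x hx =>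
              (ENNReal.ofReal_le_ofReal (hpt x hx)).trans ENNReal.ofReal_add_le
        _ = (∫⁻ x in B, ENNReal.ofReal (M₁ * L⁻¹ * (fn lam h x (u k x) * u k x * dens x)))
            + ∫⁻ x in B, ENNReal.ofReal (K * η * (u k x ^ 2 * dens x)) :=
            lintegral_add_right' _ (hi.const_mul _).aemeasurable.ennreal_ofReal
        _ ≤ ENNReal.ofReal (M₁ * L⁻¹ * M) + ENNReal.ofReal (K * η * M₂) :=
            add_le_add (lintegral_ofReal_const_mul_le (by positivity) (hM k))
              (lintegral_ofReal_const_mul_le (by positivity) hsq)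
        _ = ENNReal.ofReal (M₁ * L⁻¹ * M + K * η * M₂) :=
            (ENNReal.ofReal_add (by positivity) (by positivity)).symm
        _ ≤ ENNReal.ofReal ε := by
            refine ENNReal.ofReal_le_ofReal ?_
            have h1 : M₁ * L⁻¹ * M ≤ ε / 2 := by
              have e : M₁ * L⁻¹ * M = M₁ * M / L := by ring
              rw [e, div_le_iff₀ hL0, hL]
              field_simp
              linarith
            linarith

end Convergence

/-- Convergence of the nonlinear terms along bounded a.e.-convergent sequences
in `H¹_R(𝔹²)` with `sup_k ∫_B f(x,u_k)u_k dv_g < ∞`: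
(i) `∫_{|x|<α} f(x,|u_k|) dv_g → ∫_{|x|<α} f(x,|u|) dv_g` for every `α ∈ (0,1)`;
(ii) `∫_B F(x,u_k) dv_g → ∫_B F(x,u) dv_g`. -/
theorem stmt14 (lam : ℝ) (h : Pt → ℝ → ℝ) (hf : CriticalGrowth lam h)
    (u : ℕ → Pt → ℝ) (u₀ : Pt → ℝ)
    (huk : ∀ k, IsH1R (u k)) (hu₀ : IsH1R u₀)
    (hbdd : ∃ M : ℝ, ∀ k, enormSq (u k) ≤ M)
    (hbddL2 : ∃ M : ℝ, ∀ k, hInt (fun x => (u k x) ^ 2) ≤ M)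
    (hae : ∀ᵐ x ∂(volume.restrict B), Tendsto (fun k => u k x) atTop (nhds (u₀ x)))
    (hsup : ∃ M : ℝ, ∀ k,
      ∫⁻ x in B, ENNReal.ofReal (fn lam h x (u k x) * u k x * dens x) ≤ ENNReal.ofReal M) :
    (∀ α : ℝ, α ∈ Ioo (0 : ℝ) 1 →
      Tendsto (fun k => ∫ x in {x : Pt | ‖x‖ < α}, fn lam h x |u k x| * dens x) atTop
        (nhds (∫ x in {x : Pt | ‖x‖ < α}, fn lam h x |u₀ x| * dens x))) ∧
    Tendsto (fun k => hInt (fun x => Fn lam h x (u k x))) atTop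
      (nhds (hInt (fun x => Fn lam h x (u₀ x)))) := by
  obtain ⟨M₁, hM₁⟩ := hbdd
  obtain ⟨M₂, hM₂⟩ := hbddL2
  obtain ⟨M, hM⟩ := hsup
  have hM' : ∀ k, ∫⁻ x in B, ENNReal.ofReal (fn lam h x (u k x) * u k x * dens x)
      ≤ ENNReal.ofReal |M| :=
    fun k => (hM k).trans (ENNReal.ofReal_le_ofReal (le_abs_self M))
  refine ⟨fun α hα => ?_, ?_⟩
  · have hset : {x : Pt | ‖x‖ < α} = Metric.ball 0 α := by
      ext x
      simp
    rw [hset]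
    exact tendsto_setIntegral_fn_abs hf huk hae (abs_nonneg M) hM' hα
  · refine tendsto_hInt_Fn hf huk hae (abs_nonneg M) hM' hM₂ (abs_nonneg
      (2 * (M₁ / (2 * volume.real B)) + 1 + √(8 * (M₂ / (2 * volume.real B))))) ?_
    intro k x hx hx1
    refine ((huk k).abs_le_mul_sqrt (hM₁ k) (hM₂ k) hx hx1).trans ?_
    exact mul_le_mul_of_nonneg_right (le_abs_self _) (Real.sqrt_nonneg _)
end
end
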